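/- arXiv:1904.10385 — 2 statements merged into one kernel-verified Lean document; each statement's English description precedes it below -/
import Mathlib

section
/- Let α ≥ 0 and n ≥ 0. (a) If T₀ is norm continuous on (α,∞) and Sₙ is norm continuous on (0,∞), then R₀ is norm continuous on (nα,∞). (b) If T₀(t) is compact for every t > α and Sₙ(t) is compact for every t > 0, then R₀ is compact and norm continuous on (nα,∞). (c) If n ≥ 1, T₀ is strongly continuously differentiable on [α,∞), t ↦ S(t)x is continuously differentiable on [α,∞) for every x ∈ X (for an MR operator this is equivalent to the stated differentiability of T₀), and Sₙ is strongly continuously differentiable on [0,∞), then R₀ is strongly continuously differentiable on [nα,∞). -/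
open Set Filter MeasureTheory
open scoped Topology

noncomputable section

structure MRSetting (X : Type*) [NormedAddCommGroup X] [NormedSpace ℂ X] [CompleteSpace X]
    (X₀ : Submodule ℂ X) where
  closed : IsClosed (X₀ : Set X)
  T : ℝ → (X₀ →L[ℂ] X₀)
  S : ℝ → (X →L[ℂ] X₀)
  T_zero : T 0 = 1
  T_add : ∀ t s : ℝ, 0 ≤ t → 0 ≤ s → T (t + s) = (T t).comp (T s)
  T_cont : ∀ x : X₀, ContinuousOn (fun t => T t x) (Ici 0)
  S_zero : S 0 = 0
  S_cont : ∀ x : X, ContinuousOn (fun t => S t x) (Ici 0)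
  TS : ∀ t s : ℝ, 0 ≤ t → 0 ≤ s → ∀ x : X, T t (S s x) = S (t + s) x - S t x
  δ : ℝ → ℝ
  δ_nonneg : ∀ t : ℝ, 0 ≤ t → 0 ≤ δ t
  δ_mono : MonotoneOn δ (Ici 0)
  δ_lim : Tendsto δ (𝓝[>] 0) (𝓝 0)
  SD : (ℝ → X) → ℝ → X₀
  SD_deriv : ∀ f : ℝ → X, ContinuousOn f (Ici 0) → ∀ t ∈ Ici (0:ℝ),
    HasDerivWithinAt (fun τ : ℝ => ∫ s in (0:ℝ)..τ, S (τ - s) (f s)) (SD f t) (Ici 0) t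
  SD_cont : ∀ f : ℝ → X, ContinuousOn f (Ici 0) → ContinuousOn (SD f) (Ici 0)
  SD_bound : ∀ f : ℝ → X, ContinuousOn f (Ici 0) → ∀ t ∈ Ici (0:ℝ),
    ‖SD f t‖ ≤ δ t * ⨆ s : Icc (0:ℝ) t, ‖f (s : ℝ)‖
  SDop : (ℝ → (X₀ →L[ℂ] X)) → ℝ → (X₀ →L[ℂ] X₀)
  SDop_apply : ∀ V : ℝ → (X₀ →L[ℂ] X), (∀ x : X₀, ContinuousOn (fun s => V s x) (Ici 0)) →
    ∀ t : ℝ, ∀ x : X₀, SDop V t x = SD (fun s => V s x) t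

variable {X : Type*} [NormedAddCommGroup X] [NormedSpace ℂ X] [CompleteSpace X]
  {X₀ : Submodule ℂ X}

/-- The perturbation operator `B(U) = S ⋄ (L ∘ U)`. -/
def MRSetting.Bop (M : MRSetting X X₀) (L : X₀ →L[ℂ] X) (U : ℝ → (X₀ →L[ℂ] X₀)) :
    ℝ → (X₀ →L[ℂ] X₀) :=
  M.SDop (fun s => L.comp (U s))


/-- `W` is strongly continuously differentiable on `J`. -/
def StronglyC1On (W : ℝ → (X₀ →L[ℂ] X₀)) (J : Set ℝ) : Prop :=
  ∀ x : X₀, ∃ g : ℝ → X₀, ContinuousOn g J ∧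
    ∀ t ∈ J, HasDerivWithinAt (fun s => W s x) (g t) J t
namespace MRSetting

/-- a strongly continuous family is bounded on compact intervals -/
theorem sc_bdd {E F : Type*} [NormedAddCommGroup E] [NormedSpace ℂ E] [CompleteSpace E]
    [NormedAddCommGroup F] [NormedSpace ℂ F]
    (U : ℝ → (E →L[ℂ] F)) (hU : ∀ x, ContinuousOn (fun t => U t x) (Ici 0)) (b : ℝ) :
    ∃ C : ℝ, 0 ≤ C ∧ ∀ t ∈ Icc 0 b, ‖U t‖ ≤ C := by
  obtain ⟨C, hC⟩ := banach_steinhaus (g := fun t : Icc (0:ℝ) b => U t) (by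
    intro x
    obtain ⟨C, hC⟩ := isCompact_Icc.exists_bound_of_continuousOn
      ((hU x).mono (Icc_subset_Ici_self : Icc 0 b ⊆ Ici 0))
    exact ⟨C, fun i => hC i i.2⟩)
  exact ⟨max C 0, le_max_right _ _, fun t ht => (hC ⟨t, ht⟩).trans (le_max_left _ _)⟩

/-- joint continuity -/
theorem sc_comp {Y E F : Type*} [TopologicalSpace Y] [NormedAddCommGroup E] [NormedSpace ℂ E] [CompleteSpace E]
    [NormedAddCommGroup F] [NormedSpace ℂ F]
    (U : ℝ → (E →L[ℂ] F)) (hU : ∀ x, ContinuousOn (fun t => U t x) (Ici 0))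
    {J : Set Y} {φ : Y → ℝ} {f : Y → E} (hφ : ContinuousOn φ J) (hφ0 : ∀ s ∈ J, 0 ≤ φ s)
    (hf : ContinuousOn f J) : ContinuousOn (fun s => U (φ s) (f s)) J := by
  intro s hs
  obtain ⟨C, hC0, hC⟩ := sc_bdd U hU (φ s + 1)
  have h1 : ContinuousWithinAt (fun r => U (φ r) (f s)) J s :=
    ContinuousOn.comp (t := Ici 0) (hU (f s)) hφ (fun r hr => hφ0 r hr) s hs
  have h2 : Tendsto (fun r => U (φ r) (f r - f s)) (𝓝[J] s) (𝓝 0) := by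
    have h3 : Tendsto (fun r => C * ‖f r - f s‖) (𝓝[J] s) (𝓝 0) := by
      have : Tendsto (fun r => C * ‖f r - f s‖) (𝓝[J] s) (𝓝 (C * ‖f s - f s‖)) :=
        (((hf s hs).sub continuousWithinAt_const).norm).const_mul C
      simpa using this
    refine squeeze_zero_norm' ?_ h3
    have h4 : ∀ᶠ r in 𝓝[J] s, φ r < φ s + 1 :=
      (hφ s hs).eventually (gt_mem_nhds (by linarith))
    filter_upwards [h4, self_mem_nhdsWithin] with r hr hrJ
    exact (U (φ r)).le_of_opNorm_le (hC _ ⟨hφ0 r hrJ, hr.le⟩) _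
  have h5 := h2.add h1
  rw [zero_add] at h5
  refine h5.congr (fun r => ?_)
  simp

theorem complete (M : MRSetting X X₀) : CompleteSpace X₀ := M.closed.completeSpace_coe

variable (M : MRSetting X X₀)

theorem δ_zero : M.δ 0 = 0 := by
  apply le_antisymm _ (M.δ_nonneg 0 le_rfl)
  refine ge_of_tendsto M.δ_lim ?_
  filter_upwards [self_mem_nhdsWithin] with t ht
  exact M.δ_mono (mem_Ici.2 le_rfl) (mem_Ici.2 (le_of_lt ht)) (le_of_lt ht)

/-- small values of δ -/
theorem δ_small {ε : ℝ} (hε : 0 < ε) : ∃ τ > 0, ∀ t, 0 ≤ t → t ≤ τ → M.δ t < ε := by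
  have h : ∀ᶠ t in 𝓝[>] (0:ℝ), M.δ t < ε := M.δ_lim.eventually (gt_mem_nhds hε)
  obtain ⟨τ, hτ, hτ0⟩ := (h.and self_mem_nhdsWithin).exists
  exact ⟨τ, hτ0, fun t h0 ht => (M.δ_mono (mem_Ici.2 h0) (mem_Ici.2 (le_of_lt hτ0)) ht).trans_lt hτ⟩

theorem ker_cont {f : ℝ → X} (hf : ContinuousOn f (Ici 0)) (τ : ℝ) :
    ContinuousOn (fun s => M.S (τ - s) (f s)) (Icc 0 τ) :=
  sc_comp M.S M.S_cont (by fun_prop) (fun s hs => by linarith [hs.2])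
    (hf.mono Icc_subset_Ici_self)

theorem ker_int {f : ℝ → X} (hf : ContinuousOn f (Ici 0)) {τ : ℝ} (hτ : 0 ≤ τ) :
    IntervalIntegrable (fun s => M.S (τ - s) (f s)) volume 0 τ :=
  (M.ker_cont hf τ).intervalIntegrable_of_Icc hτ

theorem SD_unique {f : ℝ → X} (hf : ContinuousOn f (Ici 0)) {t : ℝ} (ht : 0 ≤ t) {y : X₀}
    (h : HasDerivWithinAt (fun τ : ℝ => ∫ s in (0:ℝ)..τ, M.S (τ - s) (f s)) y (Ici 0) t) :
    M.SD f t = y :=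
  (uniqueDiffOn_Ici (0:ℝ) t ht).eq_deriv _ (M.SD_deriv f hf t ht) h

theorem SD_add {f g : ℝ → X} (hf : ContinuousOn f (Ici 0)) (hg : ContinuousOn g (Ici 0))
    {t : ℝ} (ht : 0 ≤ t) : M.SD (fun s => f s + g s) t = M.SD f t + M.SD g t := by
  refine M.SD_unique (hf.add hg) ht ?_
  refine ((M.SD_deriv f hf t ht).add (M.SD_deriv g hg t ht)).congr_of_mem (fun τ hτ => ?_) ht
  simp only [map_add, Pi.add_apply]
  exact intervalIntegral.integral_add (M.ker_int hf hτ) (M.ker_int hg hτ)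

theorem SD_smul {f : ℝ → X} (hf : ContinuousOn f (Ici 0)) (c : ℂ)
    {t : ℝ} (ht : 0 ≤ t) : M.SD (fun s => c • f s) t = c • M.SD f t := by
  refine M.SD_unique (hf.const_smul c) ht ?_
  refine ((M.SD_deriv f hf t ht).const_smul c).congr_of_mem (fun τ hτ => ?_) ht
  simp only [map_smul, Pi.smul_apply]
  exact intervalIntegral.integral_smul _ _

theorem SD_sub {f g : ℝ → X} (hf : ContinuousOn f (Ici 0)) (hg : ContinuousOn g (Ici 0))
    {t : ℝ} (ht : 0 ≤ t) : M.SD (fun s => f s - g s) t = M.SD f t - M.SD g t := by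
  have h := M.SD_add (f := fun s => f s - g s) (hf.sub hg) hg ht
  simp only [sub_add_cancel] at h
  exact eq_sub_of_add_eq h.symm

theorem SD_le {f : ℝ → X} (hf : ContinuousOn f (Ici 0)) {t : ℝ} (ht : 0 ≤ t) {C : ℝ}
    (hC : ∀ s ∈ Icc 0 t, ‖f s‖ ≤ C) : ‖M.SD f t‖ ≤ M.δ t * C := by
  refine (M.SD_bound f hf t ht).trans (mul_le_mul_of_nonneg_left ?_ (M.δ_nonneg t ht))
  have : Nonempty (Icc (0:ℝ) t) := ⟨⟨0, le_rfl, ht⟩⟩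
  exact ciSup_le (fun s => hC s s.2)

theorem SD_at_zero {f : ℝ → X} (hf : ContinuousOn f (Ici 0)) : M.SD f 0 = 0 := by
  have := M.SD_le hf le_rfl (C := ‖f 0‖) (fun s hs => by
    have : s = 0 := le_antisymm hs.2 hs.1
    rw [this])
  rw [M.δ_zero, zero_mul] at this
  exact norm_le_zero_iff.1 this

theorem SD_congr {f g : ℝ → X} (hf : ContinuousOn f (Ici 0)) (hg : ContinuousOn g (Ici 0))
    {t : ℝ} (ht : 0 ≤ t) (h : ∀ s ∈ Icc 0 t, f s = g s) : M.SD f t = M.SD g t := by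
  rw [← sub_eq_zero, ← M.SD_sub hf hg ht, ← norm_le_zero_iff]
  simpa using M.SD_le (f := fun s => f s - g s) (hf.sub hg) ht (C := 0) (fun s hs => by simp [h s hs])

/-- primitives of continuous functions -/
theorem hasDeriv_int {E : Type*} [NormedAddCommGroup E] [NormedSpace ℝ E] [CompleteSpace E]
    {z : ℝ → E} {a : ℝ} (hz : ContinuousOn z (Ici a)) {t : ℝ} (ht : a ≤ t) :
    HasDerivWithinAt (fun u => ∫ s in a..u, z s) (z t) (Ici a) t := by
  have hc : Continuous (fun s => z (max s a)) :=
    hz.comp_continuous (by fun_prop) (fun s => mem_Ici.2 (le_max_right _ _))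
  have h := (hc.integral_hasStrictDerivAt a t).hasDerivAt.hasDerivWithinAt (s := Ici a)
  rw [max_eq_left ht] at h
  refine h.congr_of_mem (fun u hu => ?_) ht
  refine intervalIntegral.integral_congr (fun s hs => ?_)
  rw [uIcc_of_le hu] at hs
  simp [max_eq_left hs.1]

theorem SD_const (x : X) {t : ℝ} (ht : 0 ≤ t) : M.SD (fun _ => x) t = M.S t x := by
  have := M.complete
  refine M.SD_unique continuousOn_const ht ?_
  refine (hasDeriv_int (M.S_cont x) ht).congr_of_mem (fun τ hτ => ?_) ht
  have := intervalIntegral.integral_comp_sub_left (a := 0) (b := τ) (fun s => M.S s x) τ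
  simpa using this

theorem cont_shift {E : Type*} [TopologicalSpace E] {f : ℝ → E} {a : ℝ}
    (hf : ContinuousOn f (Ici a)) {t : ℝ} (ht : a ≤ t) :
    ContinuousOn (fun r => f (t + r)) (Ici 0) :=
  hf.comp (by fun_prop) (fun r hr => by simp only [mem_Ici] at *; linarith)

/-- the fundamental identity, integrated -/
theorem F_shift {f : ℝ → X} (hf : ContinuousOn f (Ici 0)) {t s : ℝ} (ht : 0 ≤ t) (hs : 0 ≤ s) :
    (∫ r in (0:ℝ)..(t+s), M.S (t + s - r) (f r)) - ∫ r in (0:ℝ)..s, M.S (s - r) (f (t + r))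
    = M.T s (∫ r in (0:ℝ)..t, M.S (t - r) (f r)) + M.S s (∫ r in (0:ℝ)..t, f r) := by
  have := M.complete
  have hk := M.ker_cont hf (t+s)
  have i1 : IntervalIntegrable (fun r => M.S (t + s - r) (f r)) volume 0 t :=
    (hk.mono (Icc_subset_Icc_right (by linarith))).intervalIntegrable_of_Icc ht
  have i2 : IntervalIntegrable (fun r => M.S (t + s - r) (f r)) volume t (t+s) :=
    (hk.mono (Icc_subset_Icc_left ht)).intervalIntegrable_of_Icc (by linarith)
  rw [← intervalIntegral.integral_add_adjacent_intervals i1 i2]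
  have e1 : (∫ r in t..(t+s), M.S (t + s - r) (f r))
      = ∫ r in (0:ℝ)..s, M.S (s - r) (f (t + r)) := by
    have := intervalIntegral.integral_comp_add_left (a := 0) (b := s)
      (fun r => M.S (t + s - r) (f r)) t
    rw [add_zero] at this
    rw [← this]
    refine intervalIntegral.integral_congr (fun r _ => ?_)
    congr 2
    ring
  rw [e1, add_sub_cancel_right]
  have fi : IntervalIntegrable f volume 0 t :=
    (hf.mono Icc_subset_Ici_self).intervalIntegrable_of_Icc ht
  have hT := ((M.T s).restrictScalars ℝ).intervalIntegral_comp_comm (M.ker_int hf ht)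
  have hS := ((M.S s).restrictScalars ℝ).intervalIntegral_comp_comm fi
  simp only [ContinuousLinearMap.coe_restrictScalars'] at hT hS
  rw [← hT, ← hS, ← intervalIntegral.integral_add]
  · refine intervalIntegral.integral_congr (fun r hr => ?_)
    rw [uIcc_of_le ht] at hr
    rw [M.TS s (t - r) hs (by linarith [hr.2])]
    rw [sub_add_cancel]
    congr 2
    ring
  · exact ((M.T s).continuous.comp_continuousOn (M.ker_cont hf t)).intervalIntegrable_of_Icc ht
  · exact ((M.S s).continuous.comp_continuousOn
      (hf.mono Icc_subset_Ici_self)).intervalIntegrable_of_Icc ht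

/-- the fundamental identity -/
theorem SD_shift {f : ℝ → X} (hf : ContinuousOn f (Ici 0)) {t s : ℝ} (ht : 0 ≤ t) (hs : 0 ≤ s) :
    M.SD f (t + s) = M.T s (M.SD f t) + M.SD (fun r => f (t + r)) s := by
  have hg := cont_shift hf ht
  -- the difference at shift s
  have key : ∀ σ, 0 ≤ σ → HasDerivWithinAt
      (fun h : ℝ => (∫ r in (0:ℝ)..(t+(σ+h)), M.S (t + (σ + h) - r) (f r))
        - ∫ r in (0:ℝ)..(σ+h), M.S (σ + h - r) (f (t + r)))
      (M.SD f (t + σ) - M.SD (fun r => f (t + r)) σ) (Ici 0) 0 := by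
    intro σ hσ
    have a1 := M.SD_deriv f hf (t + σ) (mem_Ici.2 (by linarith))
    have a2 := M.SD_deriv _ hg σ hσ
    have b1 : HasDerivWithinAt (fun h : ℝ => t + (σ + h)) 1 (Ici 0) 0 :=
      (((hasDerivAt_id (0:ℝ)).const_add σ).const_add t).hasDerivWithinAt
    have b2 : HasDerivWithinAt (fun h : ℝ => σ + h) 1 (Ici 0) 0 :=
      ((hasDerivAt_id (0:ℝ)).const_add σ).hasDerivWithinAt
    have c1 := HasDerivWithinAt.scomp_of_eq (h := fun h : ℝ => t + (σ + h)) (0:ℝ) a1 b1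
      (fun h hh => by simp only [mem_Ici] at *; linarith) (by simp)
    have c2 := HasDerivWithinAt.scomp_of_eq (h := fun h : ℝ => σ + h) (0:ℝ) a2 b2
      (fun h hh => by simp only [mem_Ici] at *; linarith) (by simp)
    simpa [Function.comp_def] using! c1.sub c2
  have k0 := key 0 le_rfl
  have ks := key s hs
  rw [add_zero, M.SD_at_zero hg, sub_zero] at k0
  have k1 := ((M.T s).restrictScalars ℝ).hasFDerivAt.comp_hasDerivWithinAt (0:ℝ) k0
  have k2 := k1.add_const (M.S s (∫ r in (0:ℝ)..t, f r))
  have k3 := ks.congr_of_mem (f₁ := fun h => M.T s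
      ((∫ r in (0:ℝ)..(t+(0+h)), M.S (t + (0 + h) - r) (f r))
        - ∫ r in (0:ℝ)..(0+h), M.S (0 + h - r) (f (t + r))) + M.S s (∫ r in (0:ℝ)..t, f r))
      (fun h hh => by
    have hh0 : (0:ℝ) ≤ h := hh
    rw [M.F_shift hf ht (by linarith), M.F_shift hf ht (by linarith), map_add,
      M.T_add s h hs hh0, M.TS s (0+h) hs (by linarith)]
    simp only [zero_add, ContinuousLinearMap.comp_apply]
    abel) (mem_Ici.2 le_rfl)
  have := (uniqueDiffOn_Ici (0:ℝ) 0 (mem_Ici.2 le_rfl)).eq_deriv _ k2 k3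
  simp only [ContinuousLinearMap.coe_restrictScalars'] at this
  rw [this]; abel

end MRSetting
/-- strong continuity on the half line -/
def SCont {E F : Type*} [NormedAddCommGroup E] [NormedSpace ℂ E]
    [NormedAddCommGroup F] [NormedSpace ℂ F] (V : ℝ → (E →L[ℂ] F)) : Prop :=
  ∀ x, ContinuousOn (fun s => V s x) (Ici 0)

theorem SCont.of_normCont {E F : Type*} [NormedAddCommGroup E] [NormedSpace ℂ E]
    [NormedAddCommGroup F] [NormedSpace ℂ F] {V : ℝ → (E →L[ℂ] F)}
    (h : ContinuousOn V (Ici 0)) : SCont V :=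
  fun _ => h.clm_apply continuousOn_const

/-- continuity by local uniform approximation -/
theorem contOn_of_approx {E : Type*} [NormedAddCommGroup E] {f : ℝ → E} {s : Set ℝ}
    (h : ∀ x ∈ s, ∀ ε > 0, ∃ t ∈ 𝓝[s] x, ∃ F : ℝ → E, ContinuousWithinAt F s x ∧
      ∀ y ∈ t, ‖f y - F y‖ ≤ ε) : ContinuousOn f s := by
  refine continuousOn_of_locally_uniform_approx_of_continuousWithinAt ?_
  intro x hx u hu
  obtain ⟨ε, hε, hεu⟩ := Metric.mem_uniformity_dist.1 hu
  obtain ⟨t, ht, F, hF, hd⟩ := h x hx (ε/2) (by linarith)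
  refine ⟨t, ht, F, hF, fun y hy => hεu ?_⟩
  rw [dist_eq_norm]
  linarith [hd y hy]

theorem unif_eps {E : Type*} [NormedAddCommGroup E] {V : ℝ → E} {b : ℝ}
    (hV : ContinuousOn V (Icc 0 b)) {ε : ℝ} (hε : 0 < ε) :
    ∃ ρ > 0, ∀ x ∈ Icc 0 b, ∀ y ∈ Icc 0 b, |x - y| < ρ → ‖V x - V y‖ < ε := by
  have hu := isCompact_Icc.uniformContinuousOn_of_continuous hV
  obtain ⟨ρ, hρ0, hρ⟩ := Metric.uniformContinuousOn_iff.1 hu ε hε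
  refine ⟨ρ, hρ0, fun x hx y hy h => ?_⟩
  rw [← dist_eq_norm]
  exact hρ x hx y hy h

theorem contOn_eps {E : Type*} [NormedAddCommGroup E] {f : ℝ → E} {s : Set ℝ}
    (h : ∀ x ∈ s, ∀ ε > 0, ∃ ρ > 0, ∀ y ∈ s, |y - x| < ρ → ‖f y - f x‖ < ε) :
    ContinuousOn f s := by
  rw [Metric.continuousOn_iff]
  intro x hx ε hε
  obtain ⟨ρ, hρ0, hρ⟩ := h x hx ε hε
  refine ⟨ρ, hρ0, fun y hy hd => ?_⟩
  rw [dist_eq_norm]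
  exact hρ y hy hd

namespace MRSetting

variable (M : MRSetting X X₀)

theorem op_SC {V : ℝ → (X₀ →L[ℂ] X)} (hV : SCont V) : SCont (M.SDop V) := by
  intro x
  refine (M.SD_cont _ (hV x)).congr (fun t _ => ?_)
  exact M.SDop_apply V hV t x

theorem op_sub {V W : ℝ → (X₀ →L[ℂ] X)} (hV : SCont V) (hW : SCont W) {t : ℝ} (ht : 0 ≤ t) :
    M.SDop (fun s => V s - W s) t = M.SDop V t - M.SDop W t := by
  ext1 x
  rw [_root_.sub_apply, M.SDop_apply V hV, M.SDop_apply W hW, M.SDop_apply]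
  · exact M.SD_sub (hV x) (hW x) ht
  · exact fun x => (hV x).sub (hW x)

theorem op_add {V W : ℝ → (X₀ →L[ℂ] X)} (hV : SCont V) (hW : SCont W) {t : ℝ} (ht : 0 ≤ t) :
    M.SDop (fun s => V s + W s) t = M.SDop V t + M.SDop W t := by
  ext1 x
  rw [_root_.add_apply, M.SDop_apply V hV, M.SDop_apply W hW, M.SDop_apply]
  · exact M.SD_add (hV x) (hW x) ht
  · exact fun x => (hV x).add (hW x)

theorem op_congr {V W : ℝ → (X₀ →L[ℂ] X)} (hV : SCont V) (hW : SCont W) {t : ℝ} (ht : 0 ≤ t)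
    (h : ∀ s ∈ Icc 0 t, V s = W s) : M.SDop V t = M.SDop W t := by
  ext1 x
  rw [M.SDop_apply V hV, M.SDop_apply W hW]
  exact M.SD_congr (hV x) (hW x) ht (fun s hs => by rw [h s hs])

theorem SCont_shift {V : ℝ → (X₀ →L[ℂ] X)} (hV : SCont V) {t : ℝ} (ht : 0 ≤ t) :
    SCont (fun r => V (t + r)) := fun x => cont_shift (hV x) ht

theorem op_shift {V : ℝ → (X₀ →L[ℂ] X)} (hV : SCont V) {t s : ℝ} (ht : 0 ≤ t) (hs : 0 ≤ s) :
    M.SDop V (t + s) = (M.T s).comp (M.SDop V t) + M.SDop (fun r => V (t + r)) s := by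
  ext1 x
  rw [_root_.add_apply, ContinuousLinearMap.comp_apply, M.SDop_apply V hV,
    M.SDop_apply V hV, M.SDop_apply _ (SCont_shift hV ht)]
  exact M.SD_shift (hV x) ht hs

theorem op_bound {V : ℝ → (X₀ →L[ℂ] X)} (hV : SCont V) {t C : ℝ} (ht : 0 ≤ t) (hC0 : 0 ≤ C)
    (hC : ∀ s ∈ Icc 0 t, ‖V s‖ ≤ C) : ‖M.SDop V t‖ ≤ M.δ t * C := by
  refine ContinuousLinearMap.opNorm_le_bound _ (mul_nonneg (M.δ_nonneg t ht) hC0) (fun x => ?_)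
  rw [M.SDop_apply V hV, mul_assoc]
  exact M.SD_le (hV x) ht (fun s hs => (V s).le_of_opNorm_le (hC s hs) x)

theorem T_bdd (b : ℝ) : ∃ C : ℝ, 0 ≤ C ∧ ∀ t ∈ Icc 0 b, ‖M.T t‖ ≤ C := by
  have := M.complete
  exact sc_bdd M.T M.T_cont b

theorem V_bdd (M : MRSetting X X₀) {V : ℝ → (X₀ →L[ℂ] X)} (hV : SCont V) (b : ℝ) :
    ∃ C : ℝ, 0 ≤ C ∧ ∀ t ∈ Icc 0 b, ‖V t‖ ≤ C := by
  have := M.complete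
  exact sc_bdd V hV b

theorem normcont_closed {V : ℝ → (X₀ →L[ℂ] X)} (hVc : ContinuousOn V (Ici 0)) :
    ContinuousOn (M.SDop V) (Ici 0) := by
  have hV : SCont V := SCont.of_normCont hVc
  have key : ∀ b, 0 ≤ b → ∀ ε > 0, ∃ ρ > 0, ∀ t₁ t₂, 0 ≤ t₁ → t₁ ≤ t₂ → t₂ ≤ b → t₂ - t₁ < ρ →
      ‖M.SDop V t₂ - M.SDop V t₁‖ < ε := by
    intro b hb ε hε
    obtain ⟨K, hK0, hK⟩ := M.T_bdd b
    obtain ⟨C, hC0, hC⟩ := M.V_bdd hV b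
    have hKC : 0 ≤ K * C := mul_nonneg hK0 hC0
    have hδb := M.δ_nonneg b hb
    obtain ⟨τ, hτ0, hτ⟩ := M.δ_small (ε := ε / (2 * (K * C + 1))) (by positivity)
    obtain ⟨ρ, hρ0, hρ⟩ := unif_eps (E := X₀ →L[ℂ] X) (hVc.mono (Icc_subset_Ici_self : Icc 0 b ⊆ Ici 0))
      (ε := ε / (2 * (M.δ b + 1))) (by positivity)
    refine ⟨min τ ρ, lt_min hτ0 hρ0, fun t₁ t₂ h1 h12 h2 hd => ?_⟩
    have hh0 : 0 ≤ t₂ - t₁ := by linarith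
    have e1 := M.op_shift hV hh0 h1
    rw [sub_add_cancel] at e1
    have e2 : M.SDop V t₂ - M.SDop V t₁ = (M.T t₁).comp (M.SDop V (t₂ - t₁))
        + M.SDop (fun r => V (t₂ - t₁ + r) - V r) t₁ := by
      rw [M.op_sub (SCont_shift hV hh0) hV h1, e1]; abel
    have b1 : ‖(M.T t₁).comp (M.SDop V (t₂ - t₁))‖ ≤ K * (ε / (2 * (K * C + 1)) * C) := by
      refine (ContinuousLinearMap.opNorm_comp_le _ _).trans ?_
      refine mul_le_mul (hK _ ⟨h1, by linarith⟩) ?_ (norm_nonneg _) hK0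
      refine (M.op_bound hV hh0 hC0 (fun s hs => hC s ⟨hs.1, by linarith [hs.2]⟩)).trans ?_
      exact mul_le_mul_of_nonneg_right
        (hτ _ hh0 (hd.le.trans (min_le_left _ _))).le hC0
    have b2 : ‖M.SDop (fun r => V (t₂ - t₁ + r) - V r) t₁‖
        ≤ M.δ b * (ε / (2 * (M.δ b + 1))) := by
      refine (M.op_bound (C := ε / (2 * (M.δ b + 1)))
        (fun x => ((SCont_shift hV hh0) x).sub (hV x)) h1 (by positivity) ?_).trans ?_
      · intro s hs
        have := hρ (t₂ - t₁ + s) ⟨by linarith [hs.1], by linarith [hs.2]⟩ s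
          ⟨hs.1, by linarith [hs.2]⟩ (by
            rw [add_sub_cancel_right, abs_of_nonneg hh0]
            exact hd.trans_le (min_le_right _ _))
        exact this.le
      · exact mul_le_mul_of_nonneg_right
          (M.δ_mono (mem_Ici.2 h1) (mem_Ici.2 hb) (by linarith)) (by positivity)
    have c1 : K * (ε / (2 * (K * C + 1)) * C) < ε / 2 := by
      rw [show K * (ε / (2 * (K * C + 1)) * C) = (ε / 2) * ((K * C) / (K * C + 1)) by field_simp]
      have : (K * C) / (K * C + 1) < 1 := (div_lt_one (by positivity)).2 (by linarith)
      nlinarith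
    have c2 : M.δ b * (ε / (2 * (M.δ b + 1))) < ε / 2 := by
      rw [show M.δ b * (ε / (2 * (M.δ b + 1))) = (ε / 2) * (M.δ b / (M.δ b + 1)) by field_simp]
      have : M.δ b / (M.δ b + 1) < 1 := (div_lt_one (by positivity)).2 (by linarith)
      nlinarith
    rw [e2]
    linarith [norm_add_le ((M.T t₁).comp (M.SDop V (t₂ - t₁)))
      (M.SDop (fun r => V (t₂ - t₁ + r) - V r) t₁)]
  refine contOn_eps (E := X₀ →L[ℂ] X₀) ?_
  intro t₀ ht₀ ε hε
  have ht₀' : 0 ≤ t₀ := ht₀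
  obtain ⟨ρ, hρ0, hρ⟩ := key (t₀ + 1) (by linarith) ε hε
  refine ⟨min ρ 1, lt_min hρ0 one_pos, fun t ht hd => ?_⟩
  have ht' : 0 ≤ t := ht
  have hd1 := hd.trans_le (min_le_left _ _)
  have hd2 := hd.trans_le (min_le_right _ _)
  rw [abs_lt] at hd1 hd2
  rcases le_total t t₀ with h | h
  · have h6 := norm_sub_rev (E := X₀ →L[ℂ] X₀) (M.SDop V t) (M.SDop V t₀)
    exact h6.trans_lt (hρ t t₀ ht' h (by linarith) (by linarith))
  · exact hρ t₀ t ht₀' h (by linarith) (by linarith)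

/-- freezing the family near zero -/
theorem freeze_approx {V : ℝ → (X₀ →L[ℂ] X)} (hV : SCont V) {b : ℝ} (hb : 0 < b) {ε : ℝ}
    (hε : 0 < ε) : ∃ e > 0, ∀ t ∈ Icc 0 b,
      ‖M.SDop V t - M.SDop (fun s => V (max s e)) t‖ ≤ ε := by
  obtain ⟨K, hK0, hK⟩ := M.T_bdd b
  obtain ⟨C, hC0, hC⟩ := M.V_bdd hV b
  obtain ⟨τ, hτ0, hτ⟩ := M.δ_small (ε := ε / ((K + 1) * (2 * C + 1))) (by positivity)
  have he0 : 0 < min τ b := lt_min hτ0 hb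
  refine ⟨min τ b, he0, fun t ht => ?_⟩
  set e := min τ b with he
  have heb : e ≤ b := min_le_right _ _
  have hδe := M.δ_nonneg e he0.le
  have hVe : SCont (fun s => V (max s e)) := fun x =>
    (hV x).comp (by fun_prop) (fun s _ => mem_Ici.2 (he0.le.trans (le_max_right _ _)))
  have hW : SCont (fun s => V s - V (max s e)) := fun x => (hV x).sub (hVe x)
  rw [← M.op_sub hV hVe ht.1]
  have hWb : ∀ s ∈ Icc 0 e, ‖V s - V (max s e)‖ ≤ 2 * C := by
    intro s hs
    have h1 := hC s ⟨hs.1, hs.2.trans heb⟩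
    have h2 := hC (max s e) ⟨he0.le.trans (le_max_right _ _), max_le (hs.2.trans heb) heb⟩
    linarith [norm_sub_le (V s) (V (max s e))]
  have hδe' : M.δ e * (2 * C) ≤ ε / (K + 1) := by
    have h1 : M.δ e ≤ ε / ((K + 1) * (2 * C + 1)) := (hτ e he0.le (min_le_left _ _)).le
    calc M.δ e * (2 * C) ≤ M.δ e * (2 * C + 1) := by nlinarith
      _ ≤ ε / ((K + 1) * (2 * C + 1)) * (2 * C + 1) :=
        mul_le_mul_of_nonneg_right h1 (by positivity)
      _ = ε / (K + 1) := by field_simp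
  have hεK : 0 ≤ ε / (K + 1) := by positivity
  have hεs : ε / (K + 1) * (K + 1) = ε := by field_simp
  rcases le_total t e with hte | hte
  · refine (M.op_bound hW ht.1 (by positivity) (fun s hs => hWb s ⟨hs.1, hs.2.trans hte⟩)).trans ?_
    have : M.δ t ≤ M.δ e := M.δ_mono (mem_Ici.2 ht.1) (mem_Ici.2 he0.le) hte
    nlinarith
  · have e1 := M.op_shift hW he0.le (sub_nonneg.2 hte)
    rw [add_sub_cancel] at e1
    have h2 : ‖M.SDop (fun r => V (e + r) - V (max (e + r) e)) (t - e)‖ ≤ 0 := by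
      have := M.op_bound (SCont_shift hW he0.le) (sub_nonneg.2 hte) (C := 0) le_rfl (by
        intro s hs
        rw [max_eq_left (by linarith [hs.1]), sub_self]
        exact ContinuousLinearMap.opNorm_zero.le)
      simpa using this
    have h3 : ‖M.SDop (fun s => V s - V (max s e)) e‖ ≤ ε / (K + 1) :=
      (M.op_bound hW he0.le (by positivity) hWb).trans hδe'
    rw [e1]
    have h4 : ‖(M.T (t - e)).comp (M.SDop (fun s => V s - V (max s e)) e)‖ ≤ K * (ε / (K + 1)) :=
      (ContinuousLinearMap.opNorm_comp_le _ _).trans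
        (mul_le_mul (hK _ ⟨by linarith, by linarith [ht.2]⟩) h3 (norm_nonneg _) hK0)
    have h5 := norm_add_le ((M.T (t - e)).comp (M.SDop (fun s => V s - V (max s e)) e))
      (M.SDop (fun r => V (e + r) - V (max (e + r) e)) (t - e))
    nlinarith

theorem freeze_cont {E : Type*} [TopologicalSpace E] {V : ℝ → E}
    (hVc : ContinuousOn V (Ioi 0)) {e : ℝ} (he : 0 < e) :
    Continuous (fun s => V (max s e)) :=
  hVc.comp_continuous (by fun_prop) (fun s => mem_Ioi.2 (he.trans_le (le_max_right _ _)))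

theorem normcont_open {V : ℝ → (X₀ →L[ℂ] X)} (hV : SCont V) (hVc : ContinuousOn V (Ioi 0)) :
    ContinuousOn (M.SDop V) (Ioi 0) := by
  refine contOn_of_approx (E := X₀ →L[ℂ] X₀) (fun t ht ε hε => ?_)
  have ht' : 0 < t := ht
  obtain ⟨e, he, h⟩ := M.freeze_approx hV (b := t + 1) (by linarith) hε
  refine ⟨Icc 0 (t+1), mem_nhdsWithin_of_mem_nhds (Icc_mem_nhds ht' (by linarith)), _, ?_, h⟩
  exact ((M.normcont_closed (freeze_cont hVc he).continuousOn).mono Ioi_subset_Ici_self) t ht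

theorem normcont_shift {V : ℝ → (X₀ →L[ℂ] X)} (hV : SCont V) {a α : ℝ} (ha : 0 ≤ a) (hα : 0 ≤ α)
    (hT : ContinuousOn M.T (Ioi α)) (hVc : ContinuousOn V (Ioi a)) :
    ContinuousOn (M.SDop V) (Ioi (a + α)) := by
  intro t₀ ht₀
  have ht₀' : a + α < t₀ := ht₀
  obtain ⟨c, hc1, hc2⟩ := exists_between (show a < t₀ - α by linarith)
  have hc0 : 0 ≤ c := by linarith
  have hsh : ContinuousOn (fun r => V (c + r)) (Ici 0) :=
    hVc.comp (by fun_prop) (fun r hr => by simp only [mem_Ici, mem_Ioi] at *; linarith)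
  have h1 : ContinuousOn (fun t => (M.T (t - c)).comp (M.SDop V c)
      + M.SDop (fun r => V (c + r)) (t - c)) (Ioi (c + α)) := by
    refine ContinuousOn.add ?_ ?_
    · refine ContinuousOn.clm_comp (hT.comp (by fun_prop) ?_) continuousOn_const
      intro t ht
      simp only [mem_Ioi] at *; linarith
    · refine (M.normcont_closed hsh).comp (by fun_prop) ?_
      intro t ht
      simp only [mem_Ioi, mem_Ici] at *; linarith
  have h2 : ContinuousOn (M.SDop V) (Ioi (c + α)) := by
    refine h1.congr (fun t ht => ?_)
    simp only [mem_Ioi] at ht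
    have := M.op_shift hV hc0 (s := t - c) (by linarith)
    rwa [add_sub_cancel] at this
  exact (h2.continuousAt (Ioi_mem_nhds (by linarith))).continuousWithinAt

/-- a compact operator turns strong continuity into norm continuity -/
theorem T_comp_compact {K : X₀ →L[ℂ] X₀} (hK : IsCompactOperator ⇑K) :
    ContinuousOn (fun r => (M.T r).comp K) (Ici 0) := by
  have := M.complete
  obtain ⟨Q, hQ, hKQ⟩ := IsCompactOperator.image_closedBall_subset_compact
    (f := (K : X₀ →ₗ[ℂ] X₀)) hK 1
  have hj : ContinuousOn (Function.uncurry (fun r q => M.T r q)) (Ici (0:ℝ) ×ˢ Q) :=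
    sc_comp M.T M.T_cont (φ := Prod.fst) (f := Prod.snd) continuousOn_fst
      (fun p hp => hp.1) continuousOn_snd
  refine contOn_eps (E := X₀ →L[ℂ] X₀) (fun r hr ε hε => ?_)
  obtain ⟨v, hv, hvv⟩ := hQ.mem_uniformity_of_prod hj hr
    (Metric.dist_mem_uniformity (half_pos hε))
  obtain ⟨ρ, hρ0, hρ⟩ := Metric.mem_nhdsWithin_iff.1 hv
  refine ⟨ρ, hρ0, fun p hp hpr => ?_⟩
  have hpv := hρ ⟨Metric.mem_ball.2 hpr, hp⟩
  refine lt_of_le_of_lt ?_ (half_lt_self hε)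
  refine ContinuousLinearMap.opNorm_le_of_unit_norm (by linarith) (fun x hx => ?_)
  have h1 := hvv p hpv (K x) (hKQ ⟨x, by simp [hx], rfl⟩)
  simp only [mem_setOf_eq, dist_eq_norm] at h1
  exact h1.le

/-- compactness plus almost semigroup property gives norm continuity -/
theorem normcont_of_compact {D : ℝ → (X₀ →L[ℂ] X₀)} {a : ℝ} (ha : 0 ≤ a)
    (hD : ∀ t, a < t → IsCompactOperator ⇑(D t))
    (hb : ∀ b, ∃ C, 0 ≤ C ∧ ∀ s r, a < s → 0 ≤ r → s + r ≤ b →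
      ‖D (s + r) - (M.T r).comp (D s)‖ ≤ M.δ r * C) : ContinuousOn D (Ioi a) := by
  refine contOn_of_approx (E := X₀ →L[ℂ] X₀) (fun t₀ ht₀ ε hε => ?_)
  have ht₀' : a < t₀ := ht₀
  obtain ⟨C, hC0, hC⟩ := hb (t₀ + (t₀ - a))
  obtain ⟨τ, hτ0, hτ⟩ := M.δ_small (ε := ε / (C + 1)) (by positivity)
  obtain ⟨e, he0, he⟩ := exists_between (show 0 < min (τ / 2) (t₀ - a) from
    lt_min (by linarith) (by linarith))
  have he1 := he.trans_le (min_le_left _ _)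
  have he2 := he.trans_le (min_le_right _ _)
  have hcomp := hD (t₀ - e) (by linarith)
  refine ⟨Ioo (t₀ - e) (t₀ + e), mem_nhdsWithin_of_mem_nhds (Ioo_mem_nhds (by linarith)
    (by linarith)), fun t => (M.T (t - (t₀ - e))).comp (D (t₀ - e)), ?_, ?_⟩
  · have h1 : ContinuousOn (fun t => (M.T (t - (t₀ - e))).comp (D (t₀ - e))) (Ici (t₀ - e)) :=
      (M.T_comp_compact hcomp).comp (f := fun t => t - (t₀ - e)) (by fun_prop)
        (fun t ht => by simp only [mem_Ici] at *; linarith)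
    exact (h1.continuousAt (Ici_mem_nhds (by linarith))).continuousWithinAt
  · intro t ht
    have h2 := hC (t₀ - e) (t - (t₀ - e)) (by linarith) (by linarith [ht.1]) (by linarith [ht.2])
    rw [add_sub_cancel] at h2
    refine h2.trans ?_
    have h3 := (hτ (t - (t₀ - e)) (by linarith [ht.1]) (by linarith [ht.2])).le
    have h4 : ε / (C + 1) * (C + 1) = ε := by field_simp
    have h5 : 0 < ε / (C + 1) := by positivity
    nlinarith

theorem T_normcont_of_compact {a : ℝ} (ha : 0 ≤ a)
    (hD : ∀ t, a < t → IsCompactOperator ⇑(M.T t)) : ContinuousOn M.T (Ioi a) := by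
  refine M.normcont_of_compact ha hD (fun b => ⟨0, le_rfl, fun s r hs hr _ => ?_⟩)
  rw [add_comm s r, M.T_add r s hr (by linarith), sub_self, mul_zero]
  exact ContinuousLinearMap.opNorm_zero.le

theorem op_normcont_of_compact {V : ℝ → (X₀ →L[ℂ] X)} (hV : SCont V) {a : ℝ} (ha : 0 ≤ a)
    (hD : ∀ t, a < t → IsCompactOperator ⇑(M.SDop V t)) : ContinuousOn (M.SDop V) (Ioi a) := by
  refine M.normcont_of_compact ha hD (fun b => ?_)
  obtain ⟨C, hC0, hC⟩ := M.V_bdd hV b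
  refine ⟨C, hC0, fun s r hs hr hb => ?_⟩
  have hs0 : 0 ≤ s := by linarith
  rw [M.op_shift hV hs0 hr, add_sub_cancel_left]
  exact M.op_bound (SCont_shift hV hs0) hr hC0
    (fun u hu => hC _ ⟨by linarith [hu.1], by linarith [hu.2]⟩)

/-- `x ↦ S ⋄ (φ x)` as a bounded operator -/
theorem exists_scalar_op {φ : ℝ → ℝ} (hφ : Continuous φ) {t : ℝ} (ht : 0 ≤ t) :
    ∃ P : X →L[ℂ] X₀, ∀ x, P x = M.SD (fun s => (φ s : ℂ) • x) t := by
  have hc : ∀ x : X, ContinuousOn (fun s => (φ s : ℂ) • x) (Ici 0) := fun x => by fun_prop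
  obtain ⟨C, hC⟩ := (isCompact_Icc (a := (0:ℝ)) (b := t)).exists_bound_of_continuousOn
    hφ.continuousOn
  refine ⟨LinearMap.mkContinuous
    { toFun := fun x => M.SD (fun s => (φ s : ℂ) • x) t
      map_add' := fun x y => ?_
      map_smul' := fun c x => ?_ } (M.δ t * C) (fun x => ?_), fun x => rfl⟩
  · rw [← M.SD_add (hc x) (hc y) ht]
    simp only [smul_add]
  · rw [RingHom.id_apply, ← M.SD_smul (hc x) c ht]
    simp only [smul_comm c]
  · rw [mul_assoc]
    refine M.SD_le (hc x) ht (fun s hs => ?_)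
    rw [norm_smul, Complex.norm_real]
    exact mul_le_mul_of_nonneg_right (hC s hs) (norm_nonneg _)

theorem compact_sum {ι : Type*} (s : Finset ι) (f : ι → (X₀ →L[ℂ] X₀))
    (h : ∀ i ∈ s, IsCompactOperator ⇑(f i)) : IsCompactOperator ⇑(∑ i ∈ s, f i) := by
  classical
  induction s using Finset.induction_on with
  | empty => simpa using! isCompactOperator_zero
  | insert a s ha ih =>
    rw [Finset.sum_insert ha]
    exact (h a (by simp)).add (ih (fun i hi => h i (by simp [hi])))

theorem SD_sum {ι : Type*} (s : Finset ι) (f : ι → ℝ → X) (hf : ∀ i, ContinuousOn (f i) (Ici 0))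
    {t : ℝ} (ht : 0 ≤ t) : M.SD (fun r => ∑ i ∈ s, f i r) t = ∑ i ∈ s, M.SD (f i) t := by
  classical
  induction s using Finset.induction_on with
  | empty =>
    have := M.SD_smul (f := fun _ => (0:X)) continuousOn_const 0 ht
    simpa using this
  | insert a s ha ih =>
    simp only [Finset.sum_insert ha]
    rw [M.SD_add (hf a) (continuousOn_finsetSum s (fun i _ => hf i)) ht, ih]

theorem bern_approx {E : Type*} [NormedAddCommGroup E] [NormedSpace ℂ E] {V : ℝ → E}
    (hVc : ContinuousOn V (Ici 0)) {t : ℝ} (ht : 0 < t) {ε : ℝ} (hε : 0 < ε) :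
    ∃ (n : ℕ) (φ : Fin (n+1) → ℝ → ℝ) (_ : ∀ k, Continuous (φ k)) (z : Fin (n+1) → ℝ)
      (_ : ∀ k, 0 ≤ z k), ∀ s ∈ Icc 0 t, ‖∑ k, (φ k s : ℂ) • V (z k) - V s‖ ≤ ε := by
  let f : C(unitInterval, E) :=
    ⟨fun s => V (t * s), hVc.comp_continuous (by fun_prop)
      (fun s => mem_Ici.2 (mul_nonneg ht.le s.2.1))⟩
  have hlim := bernsteinApproximation_uniform f
  rw [tendsto_iff_norm_sub_tendsto_zero] at hlim
  obtain ⟨n, hn⟩ := (hlim.eventually (gt_mem_nhds hε)).exists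
  refine ⟨n, fun k s => bernstein n k (projIcc 0 1 zero_le_one (s / t)), fun k =>
    (bernstein n k).continuous.comp (continuous_projIcc.comp (by fun_prop)),
    fun k => t * (bernstein.z k : unitInterval), fun k => mul_nonneg ht.le (bernstein.z k).2.1,
    fun s hs => ?_⟩
  have hs1 : s / t ∈ Icc (0:ℝ) 1 := ⟨div_nonneg hs.1 ht.le, (div_le_one ht).2 hs.2⟩
  have h1 := (bernsteinApproximation n f - f).norm_coe_le_norm ⟨s / t, hs1⟩
  have h2 : f ⟨s / t, hs1⟩ = V s := by
    change V (t * (s / t)) = V s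
    congr 1; field_simp
  rw [ContinuousMap.sub_apply, h2, bernsteinApproximation.apply] at h1
  simp only [projIcc_of_mem zero_le_one hs1]
  exact h1.trans hn.le

theorem compact_closed {V : ℝ → (X₀ →L[ℂ] X)} (hVc : ContinuousOn V (Ici 0))
    (hK : ∀ s, 0 ≤ s → IsCompactOperator ⇑(V s)) {t : ℝ} (ht : 0 < t) :
    IsCompactOperator ⇑(M.SDop V t) := by
  have := M.complete
  have hV : SCont V := SCont.of_normCont hVc
  choose n φ hφ z hz happ using fun m : ℕ => bern_approx (E := X₀ →L[ℂ] X) hVc ht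
    (ε := 1 / ((m:ℝ) + 1)) (by positivity)
  let W : ℕ → ℝ → (X₀ →L[ℂ] X) := fun m s => ∑ k, (φ m k s : ℂ) • V (z m k)
  have hW : ∀ m, SCont (W m) := by
    intro m x
    have h1 : ∀ s, W m s x = ∑ k, (φ m k s : ℂ) • V (z m k) x := by
      intro s
      simp only [W, _root_.sum_apply, _root_.smul_apply]
    simp only [h1]
    refine continuousOn_finsetSum _ (fun k _ => ?_)
    have := hφ m k
    fun_prop
  have hWK : ∀ m, IsCompactOperator ⇑(M.SDop (W m) t) := by
    intro m
    choose P hP using fun k => M.exists_scalar_op (hφ m k) ht.le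
    have e : M.SDop (W m) t = ∑ k, (P k).comp (V (z m k)) := by
      ext1 x
      rw [M.SDop_apply _ (hW m), _root_.sum_apply]
      simp only [ContinuousLinearMap.comp_apply, hP]
      rw [← M.SD_sum _ (fun k s => (φ m k s : ℂ) • (V (z m k)) x)
        (fun k => by have := hφ m k; fun_prop) ht.le]
      congr 1
      funext s
      simp only [W, _root_.sum_apply, _root_.smul_apply]
    rw [e]
    exact compact_sum _ _ (fun k _ => (hK _ (hz m k)).clm_comp (P k))
  refine isCompactOperator_of_tendsto (l := atTop) (F := fun n => M.SDop (W n) t) ?_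
    (Eventually.of_forall hWK)
  have hlim2 := (tendsto_one_div_add_atTop_nhds_zero_nat (𝕜 := ℝ)).const_mul (M.δ t)
  rw [mul_zero] at hlim2
  refine (tendsto_iff_norm_sub_tendsto_zero (E := X₀ →L[ℂ] X₀)).2 ?_
  refine squeeze_zero (fun n => norm_nonneg (E := X₀ →L[ℂ] X₀) _) (fun m => ?_) hlim2
  have h3 := M.op_bound (V := fun s => W m s - V s) (fun x => (hW m x).sub (hV x)) ht.le
    (C := 1 / ((m:ℝ) + 1)) (by positivity) (happ m)
  rwa [M.op_sub (hW m) hV ht.le] at h3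

theorem compact_open {V : ℝ → (X₀ →L[ℂ] X)} (hV : SCont V) (hVc : ContinuousOn V (Ioi 0))
    (hK : ∀ s, 0 < s → IsCompactOperator ⇑(V s)) {t : ℝ} (ht : 0 < t) :
    IsCompactOperator ⇑(M.SDop V t) := by
  have := M.complete
  have h : ∀ n : ℕ, ∃ e > 0, ‖M.SDop V t - M.SDop (fun s => V (max s e)) t‖ ≤ 1 / ((n:ℝ) + 1) := by
    intro n
    obtain ⟨e, he, h⟩ := M.freeze_approx hV ht (ε := 1 / ((n:ℝ) + 1)) (by positivity)
    exact ⟨e, he, h t ⟨ht.le, le_rfl⟩⟩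
  choose e he h using h
  refine isCompactOperator_of_tendsto (l := atTop)
    (F := fun n => M.SDop (fun s => V (max s (e n))) t) ?_ (Eventually.of_forall (fun n => ?_))
  · refine (tendsto_iff_norm_sub_tendsto_zero (E := X₀ →L[ℂ] X₀)).2 ?_
    refine squeeze_zero (fun n => norm_nonneg (E := X₀ →L[ℂ] X₀) _) (fun n => ?_)
      tendsto_one_div_add_atTop_nhds_zero_nat
    exact (norm_sub_rev (E := X₀ →L[ℂ] X₀) _ _).trans_le (h n)
  · exact M.compact_closed (freeze_cont hVc (he n)).continuousOn
      (fun s _ => hK _ ((he n).trans_le (le_max_right _ _))) ht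

theorem compact_shift {V : ℝ → (X₀ →L[ℂ] X)} (hV : SCont V) {a α : ℝ} (ha : 0 ≤ a) (hα : 0 ≤ α)
    (hT : ∀ t, α < t → IsCompactOperator ⇑(M.T t)) (hVc : ContinuousOn V (Ioi a))
    (hK : ∀ s, a < s → IsCompactOperator ⇑(V s)) {t : ℝ} (ht : a + α < t) :
    IsCompactOperator ⇑(M.SDop V t) := by
  obtain ⟨c, hc1, hc2⟩ := exists_between (show a < t - α by linarith)
  have hsh : ContinuousOn (fun r => V (c + r)) (Ici 0) :=
    hVc.comp (by fun_prop) (fun r hr => by simp only [mem_Ici, mem_Ioi] at *; linarith)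
  have e := M.op_shift hV (t := c) (s := t - c) (by linarith) (by linarith)
  rw [add_sub_cancel] at e
  rw [e]
  exact ((hT (t - c) (by linarith)).comp_clm _).add
    (M.compact_closed hsh (fun s hs => hK _ (by linarith)) (by linarith))

end MRSetting
/-- continuous differentiability on `[a,∞)` -/
def VC1 {E : Type*} [NormedAddCommGroup E] [NormedSpace ℝ E] (u : ℝ → E) (a : ℝ) : Prop :=
  ∃ g : ℝ → E, ContinuousOn g (Ici a) ∧ ∀ t ∈ Ici a, HasDerivWithinAt u (g t) (Ici a) t

section VC1

variable {E : Type*} [NormedAddCommGroup E] [NormedSpace ℝ E]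

theorem VC1.add {u v : ℝ → E} {a : ℝ} (hu : VC1 u a) (hv : VC1 v a) :
    VC1 (fun t => u t + v t) a := by
  obtain ⟨g, hg, hug⟩ := hu
  obtain ⟨h, hh, hvh⟩ := hv
  exact ⟨fun t => g t + h t, hg.add hh, fun t ht => (hug t ht).add (hvh t ht)⟩

theorem VC1.mono {u : ℝ → E} {a b : ℝ} (hu : VC1 u a) (hab : a ≤ b) : VC1 u b := by
  obtain ⟨g, hg, hug⟩ := hu
  have h : Ici b ⊆ Ici a := Ici_subset_Ici.2 hab
  exact ⟨g, hg.mono h, fun t ht => (hug t (h ht)).mono h⟩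

theorem VC1.congr {u v : ℝ → E} {a : ℝ} (hu : VC1 u a) (h : ∀ t ∈ Ici a, v t = u t) :
    VC1 v a := by
  obtain ⟨g, hg, hug⟩ := hu
  exact ⟨g, hg, fun t ht => (hug t ht).congr_of_mem h ht⟩

theorem VC1.shift {u : ℝ → E} {a : ℝ} (hu : VC1 u a) (c : ℝ) :
    VC1 (fun t => u (t - c)) (c + a) := by
  obtain ⟨g, hg, hug⟩ := hu
  have hm : MapsTo (fun t => t - c) (Ici (c + a)) (Ici a) := fun t ht => by
    simp only [mem_Ici] at *; linarith
  refine ⟨fun t => g (t - c), hg.comp (by fun_prop) hm, fun t ht => ?_⟩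
  have h1 : HasDerivWithinAt (fun t : ℝ => t - c) 1 (Ici (c + a)) t :=
    ((hasDerivAt_id t).sub_const c).hasDerivWithinAt
  have := (hug (t - c) (hm ht)).scomp t h1 hm
  simpa [Function.comp_def] using! this

theorem VC1.sum {ι : Type*} (s : Finset ι) {u : ι → ℝ → E} {a : ℝ} (h : ∀ i ∈ s, VC1 (u i) a) :
    VC1 (fun t => ∑ i ∈ s, u i t) a := by
  classical
  induction s using Finset.induction_on with
  | empty =>
    refine ⟨fun _ => 0, continuousOn_const, fun t _ => ?_⟩
    simpa using hasDerivWithinAt_const t (Ici a) (0:E)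
  | insert i s hi ih =>
    simp only [Finset.sum_insert hi]
    exact (h i (by simp)).add (ih (fun j hj => h j (by simp [hj])))

/-- mean value estimate -/
theorem mvt_est {f f' : ℝ → E} (hd : ∀ t ∈ Ici (0:ℝ), HasDerivWithinAt f (f' t) (Ici 0) t)
    {r h C : ℝ} (hr : 0 ≤ r) (hh : 0 ≤ h) (y : E) (hC : ∀ u ∈ Icc r (r + h), ‖f' u - y‖ ≤ C) :
    ‖f (r + h) - f r - h • y‖ ≤ C * h := by
  have hsub : Icc r (r + h) ⊆ Ici 0 := fun u hu => hr.trans hu.1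
  have h1 : ∀ u ∈ Icc r (r + h),
      HasDerivWithinAt (fun u => f u - u • y) (f' u - y) (Icc r (r+h)) u := by
    intro u hu
    have h2 := ((hasDerivAt_id u).smul_const y).hasDerivWithinAt (s := Icc r (r + h))
    simpa using! ((hd u (hsub hu)).mono hsub).sub h2
  have h3 := (convex_Icc r (r+h)).norm_image_sub_le_of_norm_hasDerivWithin_le h1 hC
    (left_mem_Icc.2 (by linarith)) (right_mem_Icc.2 (by linarith))
  have h4 : f (r + h) - (r + h) • y - (f r - r • y) = f (r + h) - f r - h • y := by
    rw [add_smul]; abel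
  rw [h4, add_sub_cancel_left, Real.norm_of_nonneg hh] at h3
  exact h3

end VC1

namespace MRSetting

variable (M : MRSetting X X₀)

theorem SD_C1 {f f' : ℝ → X} (hf' : ContinuousOn f' (Ici 0))
    (hd : ∀ t ∈ Ici (0:ℝ), HasDerivWithinAt f (f' t) (Ici 0) t) (hf0 : f 0 = 0) :
    ∀ t ∈ Ici (0:ℝ), HasDerivWithinAt (M.SD f) (M.SD f' t) (Ici 0) t := by
  have := M.complete
  have hf : ContinuousOn f (Ici 0) := fun t ht => (hd t ht).continuousWithinAt
  have hright : ∀ t, 0 ≤ t → HasDerivWithinAt (M.SD f) (M.SD f' t) (Ioi t) t := by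
    intro t ht
    rw [hasDerivWithinAt_iff_isLittleO, Asymptotics.isLittleO_iff]
    intro ε hε
    obtain ⟨C, hC⟩ := isCompact_Icc.exists_bound_of_continuousOn
      (hf'.mono (Icc_subset_Ici_self : Icc 0 (1:ℝ) ⊆ Ici 0))
    have hC0 : 0 ≤ C := (norm_nonneg _).trans (hC 0 ⟨le_rfl, zero_le_one⟩)
    have hδt := M.δ_nonneg t ht
    obtain ⟨τ, hτ0, hτ⟩ := M.δ_small (ε := (ε / 2) / (‖M.T t‖ * C + 1)) (by positivity)
    obtain ⟨ρ, hρ0, hρ⟩ := unif_eps (hf'.mono (Icc_subset_Ici_self : Icc 0 (t + 1) ⊆ Ici 0))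
      (ε := (ε / 2) / (M.δ t + 1)) (by positivity)
    have hmem : Ioo t (t + min 1 (min τ ρ)) ∈ 𝓝[>] t :=
      Ioo_mem_nhdsGT (by have := lt_min one_pos (lt_min hτ0 hρ0); linarith)
    filter_upwards [hmem] with x hx
    obtain ⟨h, hhx⟩ : ∃ h, h = x - t := ⟨_, rfl⟩
    have hh0 : 0 < h := by rw [hhx]; linarith [hx.1]
    have hhm : h < min 1 (min τ ρ) := by rw [hhx]; linarith [hx.2]
    have hh1 : h < 1 := hhm.trans_le (min_le_left _ _)
    have hhτ : h < τ := hhm.trans_le ((min_le_right _ _).trans (min_le_left _ _))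
    have hhρ : h < ρ := hhm.trans_le ((min_le_right _ _).trans (min_le_right _ _))
    have hx' : x = h + t := by rw [hhx]; ring
    rw [← hhx, hx', M.SD_shift hf hh0.le ht]
    have hsh := cont_shift hf hh0.le
    have hsm : ContinuousOn (fun r => (h : ℂ) • f' r) (Ici 0) := hf'.const_smul _
    have e1 : M.SD (fun r => f (h + r) - f r - (h : ℂ) • f' r) t
        = M.SD (fun r => f (h + r)) t - M.SD f t - h • M.SD f' t := by
      rw [M.SD_sub (f := fun r => f (h + r) - f r) (hsh.sub hf) hsm ht, M.SD_sub hsh hf ht,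
        M.SD_smul hf' _ ht, Complex.coe_smul]
    have e2 : M.T t (M.SD f h) + M.SD (fun r => f (h + r)) t - M.SD f t - h • M.SD f' t
        = M.T t (M.SD f h) + M.SD (fun r => f (h + r) - f r - (h : ℂ) • f' r) t := by
      rw [e1]; abel
    rw [e2, Real.norm_of_nonneg hh0.le]
    have b1 : ‖M.T t (M.SD f h)‖ ≤ ‖M.T t‖ * (((ε / 2) / (‖M.T t‖ * C + 1)) * (C * h)) := by
      refine (M.T t).le_opNorm_of_le ?_
      refine (M.SD_le hf hh0.le (C := C * h) ?_).trans
        (mul_le_mul_of_nonneg_right (hτ h hh0.le hhτ.le).le (by positivity))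
      intro s hs
      have := mvt_est hd (r := 0) (h := s) (C := C) le_rfl hs.1 0 (by
        intro u hu
        rw [sub_zero]
        exact hC u ⟨hu.1, by linarith [hu.2, hs.2]⟩)
      rw [hf0, zero_add, sub_zero, smul_zero, sub_zero] at this
      exact this.trans (mul_le_mul_of_nonneg_left hs.2 hC0)
    have b2 : ‖M.SD (fun r => f (h + r) - f r - (h : ℂ) • f' r) t‖
        ≤ M.δ t * (((ε / 2) / (M.δ t + 1)) * h) := by
      refine M.SD_le (f := fun r => f (h + r) - f r - (h : ℂ) • f' r) ((hsh.sub hf).sub hsm) ht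
        (fun s hs => ?_)
      rw [Complex.coe_smul, add_comm h s]
      refine mvt_est hd hs.1 hh0.le (f' s) (fun u hu => ?_)
      refine (hρ u ⟨hs.1.trans hu.1, by linarith [hu.2, hs.2]⟩ s ⟨hs.1, by linarith [hs.2]⟩ ?_).le
      rw [abs_of_nonneg (by linarith [hu.1])]
      linarith [hu.2]
    have c1 : ‖M.T t‖ * (((ε / 2) / (‖M.T t‖ * C + 1)) * (C * h)) ≤ ε / 2 * h := by
      have hTC : 0 ≤ ‖M.T t‖ * C := by positivity
      rw [show ‖M.T t‖ * (((ε / 2) / (‖M.T t‖ * C + 1)) * (C * h))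
        = (ε / 2 * h) * ((‖M.T t‖ * C) / (‖M.T t‖ * C + 1)) by ring]
      have : (‖M.T t‖ * C) / (‖M.T t‖ * C + 1) ≤ 1 := (div_le_one (by positivity)).2 (by linarith)
      exact mul_le_of_le_one_right (by positivity) this
    have c2 : M.δ t * (((ε / 2) / (M.δ t + 1)) * h) ≤ ε / 2 * h := by
      rw [show M.δ t * (((ε / 2) / (M.δ t + 1)) * h) = (ε / 2 * h) * (M.δ t / (M.δ t + 1)) by ring]
      have : M.δ t / (M.δ t + 1) ≤ 1 := (div_le_one (by positivity)).2 (by linarith)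
      exact mul_le_of_le_one_right (by positivity) this
    refine (norm_add_le _ _).trans ?_
    linarith
  have hint : ∀ t ∈ Ici (0:ℝ), M.SD f t = ∫ s in (0:ℝ)..t, M.SD f' s := by
    intro t ht
    have h1 := intervalIntegral.integral_eq_sub_of_hasDeriv_right_of_le (f := M.SD f)
      (f' := M.SD f') (mem_Ici.1 ht) ((M.SD_cont f hf).mono Icc_subset_Ici_self)
      (fun x hx => hright x hx.1.le)
      (((M.SD_cont f' hf').mono Icc_subset_Ici_self).intervalIntegrable_of_Icc ht)
    rw [h1, M.SD_at_zero hf, sub_zero]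
  intro t ht
  exact (hasDeriv_int (M.SD_cont f' hf') ht).congr_of_mem hint ht

/-- weighted estimate -/
theorem weighted (L : X₀ →L[ℂ] X) : ∃ lam : ℝ, 0 ≤ lam ∧ ∀ f : ℝ → X₀, ContinuousOn f (Ici 0) →
    ∀ t C, 0 ≤ t → 0 ≤ C → (∀ s ∈ Icc 0 t, ‖f s‖ ≤ C * Real.exp (lam * s)) →
    ‖M.SD (fun s => L (f s)) t‖ ≤ 1 / 2 * (C * Real.exp (lam * t)) := by
  obtain ⟨τ, hτ0, hτ⟩ := M.δ_small (ε := 1 / (4 * (‖L‖ + 1))) (by positivity)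
  set lam := Real.log (2 * ‖M.T τ‖ + 1) / τ with hlam
  have hl0 : 0 ≤ lam := div_nonneg (Real.log_nonneg (by linarith [norm_nonneg (M.T τ)])) hτ0.le
  have hexp : Real.exp (lam * τ) = 2 * ‖M.T τ‖ + 1 := by
    rw [hlam, div_mul_cancel₀ _ hτ0.ne', Real.exp_log (by positivity)]
  have hq : ∀ t, 0 ≤ t → t ≤ τ → M.δ t * ‖L‖ ≤ 1 / 4 := by
    intro t ht htτ
    have h1 := (hτ t ht htτ).le
    calc M.δ t * ‖L‖ ≤ 1 / (4 * (‖L‖ + 1)) * (‖L‖ + 1) :=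
          mul_le_mul h1 (by linarith) L.opNorm_nonneg (by positivity)
      _ = 1 / 4 := by field_simp
  have base : ∀ f : ℝ → X₀, ContinuousOn f (Ici 0) → ∀ t c, 0 ≤ t → t ≤ τ → 0 ≤ c →
      (∀ s ∈ Icc 0 t, ‖f s‖ ≤ c) → ‖M.SD (fun s => L (f s)) t‖ ≤ 1 / 4 * c := by
    intro f hf t c ht htτ hc hb
    refine (M.SD_le (C := ‖L‖ * c) (L.continuous.comp_continuousOn hf) ht
      (fun s hs => L.le_opNorm_of_le (hb s hs))).trans ?_
    rw [← mul_assoc]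
    exact mul_le_mul_of_nonneg_right (hq t ht htτ) hc
  have hmono : ∀ s t C : ℝ, 0 ≤ C → s ≤ t → C * Real.exp (lam * s) ≤ C * Real.exp (lam * t) := by
    intro s t C hC hst
    exact mul_le_mul_of_nonneg_left
      (Real.exp_le_exp.2 (mul_le_mul_of_nonneg_left hst hl0)) hC
  refine ⟨lam, hl0, fun f hf => ?_⟩
  have key : ∀ k : ℕ, ∀ t C, 0 ≤ t → t ≤ (k + 1) * τ → 0 ≤ C →
      (∀ s ∈ Icc 0 t, ‖f s‖ ≤ C * Real.exp (lam * s)) →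
      ‖M.SD (fun s => L (f s)) t‖ ≤ 1 / 2 * (C * Real.exp (lam * t)) := by
    intro k
    have small : ∀ t C, 0 ≤ t → t ≤ τ → 0 ≤ C →
        (∀ s ∈ Icc 0 t, ‖f s‖ ≤ C * Real.exp (lam * s)) →
        ‖M.SD (fun s => L (f s)) t‖ ≤ 1 / 2 * (C * Real.exp (lam * t)) := by
      intro t C ht htτ hC hb
      have h0 : 0 ≤ C * Real.exp (lam * t) := by positivity
      have := base f hf t _ ht htτ h0
        (fun s hs => (hb s hs).trans (hmono s t C hC hs.2))
      linarith
    induction k with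
    | zero =>
      intro t C ht htτ hC hb
      exact small t C ht (by simpa using htτ) hC hb
    | succ k ih =>
      intro t C ht htτ hC hb
      rcases le_total t τ with h | h
      · exact small t C ht h hC hb
      have h0 : 0 ≤ C * Real.exp (lam * t) := by positivity
      have ht1 : 0 ≤ t - τ := by linarith
      have e := M.SD_shift (f := fun s => L (f s)) (L.continuous.comp_continuousOn hf)
        ht1 hτ0.le
      rw [sub_add_cancel] at e
      have b1 := ih (t - τ) C ht1 (by push_cast at htτ; linarith) hC
        (fun s hs => hb s ⟨hs.1, by linarith [hs.2]⟩)
      have b2 := base (fun r => f (t - τ + r)) (cont_shift hf ht1) τ _ hτ0.le le_rfl h0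
        (fun s hs => (hb _ ⟨by linarith [hs.1], by linarith [hs.2]⟩).trans
          (hmono _ t C hC (by linarith [hs.2])))
      have b3 : ‖M.T τ (M.SD (fun s => L (f s)) (t - τ))‖ ≤ 1 / 4 * (C * Real.exp (lam * t)) := by
        refine ((M.T τ).le_opNorm_of_le b1).trans ?_
        have h5 : Real.exp (lam * t) = Real.exp (lam * τ) * Real.exp (lam * (t - τ)) := by
          rw [← Real.exp_add]; congr 1; ring
        rw [h5, hexp]
        have h6 : 0 ≤ C * Real.exp (lam * (t - τ)) := by positivity
        nlinarith
      rw [e]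
      refine (norm_add_le _ _).trans ?_
      linarith
  intro t C ht hC hb
  obtain ⟨k, hk⟩ := exists_nat_ge (t / τ)
  refine key k t C ht ?_ hC hb
  rw [div_le_iff₀ hτ0] at hk
  linarith

/-- vector valued version of `B` -/
def bv (L : X₀ →L[ℂ] X) (f : ℝ → X₀) : ℝ → X₀ := M.SD (fun s => L (f s))

variable (L : X₀ →L[ℂ] X)

theorem L_cont {f : ℝ → X₀} {s : Set ℝ} (hf : ContinuousOn f s) :
    ContinuousOn (fun s => L (f s)) s := L.continuous.comp_continuousOn hf

theorem bv_iter_cont {f : ℝ → X₀} (hf : ContinuousOn f (Ici 0)) (k : ℕ) :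
    ContinuousOn ((M.bv L)^[k] f) (Ici 0) := by
  induction k with
  | zero => exact hf
  | succ k ih =>
    rw [Function.iterate_succ_apply']
    exact M.SD_cont _ (L_cont L ih)

theorem bv_iter_bound : ∃ lam : ℝ, 0 ≤ lam ∧ ∀ f : ℝ → X₀, ContinuousOn f (Ici 0) →
    ∀ b C, 0 ≤ C → (∀ s ∈ Icc 0 b, ‖f s‖ ≤ C) →
    ∀ k : ℕ, ∀ s ∈ Icc 0 b, ‖(M.bv L)^[k] f s‖ ≤ (1 / 2) ^ k * C * Real.exp (lam * s) := by
  obtain ⟨lam, hl0, hw⟩ := M.weighted L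
  refine ⟨lam, hl0, fun f hf b C hC hb k => ?_⟩
  induction k with
  | zero =>
    intro s hs
    have h1 : 1 ≤ Real.exp (lam * s) := Real.one_le_exp (mul_nonneg hl0 hs.1)
    have h2 := hb s hs
    simp only [Function.iterate_zero, id, pow_zero, one_mul]
    nlinarith
  | succ k ih =>
    intro s hs
    rw [Function.iterate_succ_apply']
    have := hw _ (M.bv_iter_cont L hf k) s ((1/2)^k * C) hs.1 (by positivity)
      (fun r hr => ih r ⟨hr.1, hr.2.trans hs.2⟩)
    refine this.trans (le_of_eq ?_)
    ring

theorem L_SC {U : ℝ → (X₀ →L[ℂ] X₀)} (hU : SCont U) : SCont (fun s => L.comp (U s)) :=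
  fun x => L_cont L (hU x)

theorem Bop_iter_SC {U : ℝ → (X₀ →L[ℂ] X₀)} (hU : SCont U) (k : ℕ) :
    SCont ((M.Bop L)^[k] U) := by
  induction k with
  | zero => exact hU
  | succ k ih =>
    rw [Function.iterate_succ_apply']
    exact M.op_SC (L_SC L ih)

theorem Bop_iter_apply {U : ℝ → (X₀ →L[ℂ] X₀)} (hU : SCont U) (k : ℕ) (x : X₀) :
    (fun t => (M.Bop L)^[k] U t x) = (M.bv L)^[k] (fun t => U t x) := by
  induction k with
  | zero => rfl
  | succ k ih =>
    rw [Function.iterate_succ_apply', Function.iterate_succ_apply', ← ih]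
    funext t
    exact M.SDop_apply _ (L_SC L (M.Bop_iter_SC L hU k)) t x

theorem Bop_iter_bound {U : ℝ → (X₀ →L[ℂ] X₀)} (hU : SCont U) (b : ℝ) :
    ∃ C, 0 ≤ C ∧ ∀ k : ℕ, ∀ t ∈ Icc 0 b, ‖(M.Bop L)^[k] U t‖ ≤ (1 / 2) ^ k * C := by
  have := M.complete
  obtain ⟨lam, hl0, hw⟩ := M.bv_iter_bound L
  obtain ⟨C, hC0, hC⟩ := sc_bdd U hU b
  refine ⟨C * Real.exp (lam * b), by positivity, fun k t ht => ?_⟩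
  refine ContinuousLinearMap.opNorm_le_bound _ (by positivity) (fun x => ?_)
  have h1 := hw _ (hU x) b (C * ‖x‖) (by positivity)
    (fun s hs => (U s).le_of_opNorm_le (hC s hs) x) k t ht
  rw [← M.Bop_iter_apply L hU k x] at h1
  refine h1.trans ?_
  have h2 : Real.exp (lam * t) ≤ Real.exp (lam * b) :=
    Real.exp_le_exp.2 (mul_le_mul_of_nonneg_left ht.2 hl0)
  calc (1 / 2) ^ k * (C * ‖x‖) * Real.exp (lam * t)
      ≤ (1 / 2) ^ k * (C * ‖x‖) * Real.exp (lam * b) :=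
        mul_le_mul_of_nonneg_left h2 (by positivity)
    _ = _ := by ring

theorem T_SC : SCont M.T := M.T_cont

theorem R_step {R : ℝ → (X₀ →L[ℂ] X₀)} (hRsc : SCont R)
    (hRfix : ∀ t ∈ Ici (0:ℝ), R t = M.T t + M.Bop L R t) (k : ℕ) : ∀ t ∈ Ici (0:ℝ),
    (M.Bop L)^[k] R t = (M.Bop L)^[k] M.T t + (M.Bop L)^[k+1] R t := by
  induction k with
  | zero => exact hRfix
  | succ k ih =>
    intro t ht
    have hT := L_SC L (M.Bop_iter_SC L M.T_SC k)
    have hR := L_SC L (M.Bop_iter_SC L hRsc (k+1))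
    have e1 : (M.Bop L)^[k+1] R = M.SDop (fun s => L.comp ((M.Bop L)^[k] R s)) :=
      Function.iterate_succ_apply' _ k R
    have e2 : (M.Bop L)^[k+1] M.T = M.SDop (fun s => L.comp ((M.Bop L)^[k] M.T s)) :=
      Function.iterate_succ_apply' _ k M.T
    have e3 : (M.Bop L)^[k+1+1] R = M.SDop (fun s => L.comp ((M.Bop L)^[k+1] R s)) :=
      Function.iterate_succ_apply' _ (k+1) R
    have h1 := M.op_add hT hR ht
    have h0 : M.SDop (fun s => L.comp ((M.Bop L)^[k] R s)) t = _ :=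
      (M.op_congr (L_SC L (M.Bop_iter_SC L hRsc k)) (fun x => (hT x).add (hR x)) ht (by
        intro s hs
        have h2 := ih s hs.1
        exact (congrArg (fun W => L.comp W) h2).trans (ContinuousLinearMap.comp_add _ _ _))).trans h1
    rw [← e2, ← e3] at h0
    exact (congrFun e1 t).trans h0

theorem R_expand {R : ℝ → (X₀ →L[ℂ] X₀)} (hRsc : SCont R)
    (hRfix : ∀ t ∈ Ici (0:ℝ), R t = M.T t + M.Bop L R t) (n K : ℕ) : ∀ t ∈ Ici (0:ℝ),
    (M.Bop L)^[n] R t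
    = ∑ k ∈ Finset.range K, (M.Bop L)^[n + k] M.T t + (M.Bop L)^[n + K] R t := by
  induction K with
  | zero => intro t _; simp
  | succ K ih =>
    intro t ht
    rw [ih t ht, Finset.sum_range_succ, M.R_step L hRsc hRfix (n + K) t ht]
    exact (add_assoc _ _ _).symm

end MRSetting

namespace MRSetting

variable (M : MRSetting X X₀) (L : X₀ →L[ℂ] X)

theorem Bop_succ (U : ℝ → (X₀ →L[ℂ] X₀)) (k : ℕ) :
    (M.Bop L)^[k+1] U = M.SDop (fun s => L.comp ((M.Bop L)^[k] U s)) :=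
  Function.iterate_succ_apply' _ k U

theorem iter_nc_lt {α : ℝ} (hα : 0 ≤ α) (hT : ContinuousOn M.T (Ioi α)) (k : ℕ) :
    ContinuousOn ((M.Bop L)^[k] M.T) (Ioi (((k:ℝ) + 1) * α)) := by
  induction k with
  | zero => simpa using hT
  | succ k ih =>
    rw [M.Bop_succ]
    have := M.normcont_shift (L_SC L (M.Bop_iter_SC L M.T_SC k)) (a := ((k:ℝ)+1) * α)
      (by positivity) hα hT (continuousOn_const.clm_comp ih)
    refine this.mono (Ioi_subset_Ioi (le_of_eq ?_))
    push_cast; ring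

theorem iter_nc_ge {n : ℕ} (hS : ContinuousOn ((M.Bop L)^[n] M.T) (Ioi 0)) (j : ℕ) :
    ContinuousOn ((M.Bop L)^[n + j] M.T) (Ioi 0) := by
  induction j with
  | zero => exact hS
  | succ j ih =>
    rw [← add_assoc, M.Bop_succ]
    exact M.normcont_open (L_SC L (M.Bop_iter_SC L M.T_SC _)) (continuousOn_const.clm_comp ih)

theorem iter_nc {α : ℝ} (hα : 0 ≤ α) (hT : ContinuousOn M.T (Ioi α)) {n : ℕ}
    (hS : ContinuousOn ((M.Bop L)^[n] M.T) (Ioi 0)) (k : ℕ) :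
    ContinuousOn ((M.Bop L)^[k] M.T) (Ioi ((n:ℝ) * α)) := by
  rcases lt_or_ge k n with h | h
  · refine (M.iter_nc_lt L hα hT k).mono (Ioi_subset_Ioi ?_)
    have : ((k:ℝ) + 1) ≤ n := by exact_mod_cast h
    exact mul_le_mul_of_nonneg_right this hα
  · obtain ⟨j, rfl⟩ := Nat.exists_eq_add_of_le h
    exact (M.iter_nc_ge L hS j).mono (Ioi_subset_Ioi (by positivity))

theorem iter_cp_lt {α : ℝ} (hα : 0 ≤ α) (hT : ∀ t, α < t → IsCompactOperator ⇑(M.T t)) (k : ℕ) :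
    ∀ t, ((k:ℝ) + 1) * α < t → IsCompactOperator ⇑((M.Bop L)^[k] M.T t) := by
  induction k with
  | zero => simpa using hT
  | succ k ih =>
    intro t ht
    rw [M.Bop_succ]
    refine M.compact_shift (L_SC L (M.Bop_iter_SC L M.T_SC k)) (a := ((k:ℝ)+1) * α)
      (by positivity) hα hT
      (continuousOn_const.clm_comp (M.iter_nc_lt L hα (M.T_normcont_of_compact hα hT) k))
      (fun s hs => (ih s hs).clm_comp L) ?_
    push_cast at ht; linarith

theorem iter_cp_ge {n : ℕ} (hS : ContinuousOn ((M.Bop L)^[n] M.T) (Ioi 0))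
    (hK : ∀ t, 0 < t → IsCompactOperator ⇑((M.Bop L)^[n] M.T t)) (j : ℕ) :
    ∀ t, 0 < t → IsCompactOperator ⇑((M.Bop L)^[n + j] M.T t) := by
  induction j with
  | zero => exact hK
  | succ j ih =>
    intro t ht
    rw [← add_assoc, M.Bop_succ]
    exact M.compact_open (L_SC L (M.Bop_iter_SC L M.T_SC _))
      (continuousOn_const.clm_comp (M.iter_nc_ge L hS j)) (fun s hs => (ih s hs).clm_comp L) ht

/-- uniform approximation of `R` by the partial sums -/
theorem R_approx {R : ℝ → (X₀ →L[ℂ] X₀)} (hRsc : SCont R)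
    (hRfix : ∀ t ∈ Ici (0:ℝ), R t = M.T t + M.Bop L R t) (b : ℝ) :
    ∃ C, 0 ≤ C ∧ ∀ n K : ℕ, ∀ t ∈ Icc 0 b,
      ‖(M.Bop L)^[n] R t - ∑ k ∈ Finset.range K, (M.Bop L)^[n + k] M.T t‖ ≤ (1 / 2) ^ (n + K) * C := by
  obtain ⟨C, hC0, hC⟩ := M.Bop_iter_bound L hRsc b
  refine ⟨C, hC0, fun n K t ht => ?_⟩
  rw [M.R_expand L hRsc hRfix n K t ht.1, add_sub_cancel_left]
  exact hC (n + K) t ht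

theorem half_small (C : ℝ) {ε : ℝ} (hε : 0 < ε) : ∃ K : ℕ, (1 / 2) ^ K * C ≤ ε := by
  have h : Tendsto (fun K : ℕ => ((1:ℝ) / 2) ^ K * C) atTop (𝓝 (0 * C)) :=
    (tendsto_pow_atTop_nhds_zero_of_lt_one (by norm_num) (by norm_num)).mul_const C
  rw [zero_mul] at h
  exact (h.eventually (Iic_mem_nhds hε)).exists

theorem part_a {R : ℝ → (X₀ →L[ℂ] X₀)} (hRsc : SCont R)
    (hRfix : ∀ t ∈ Ici (0:ℝ), R t = M.T t + M.Bop L R t) {α : ℝ} (hα : 0 ≤ α)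
    (hT : ContinuousOn M.T (Ioi α)) {n : ℕ}
    (hS : ContinuousOn ((M.Bop L)^[n] M.T) (Ioi 0)) : ContinuousOn R (Ioi ((n:ℝ) * α)) := by
  have hna : 0 ≤ (n:ℝ) * α := by positivity
  refine contOn_of_approx (E := X₀ →L[ℂ] X₀) (fun t ht ε hε => ?_)
  obtain ⟨C, hC0, hC⟩ := M.R_approx L hRsc hRfix (t + 1)
  obtain ⟨K, hK⟩ := half_small C hε
  refine ⟨Ioi ((n:ℝ) * α) ∩ Iio (t + 1),
    inter_mem self_mem_nhdsWithin (mem_nhdsWithin_of_mem_nhds (Iio_mem_nhds (by linarith))),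
    fun y => ∑ k ∈ Finset.range K, (M.Bop L)^[k] M.T y, ?_, ?_⟩
  · exact (continuousOn_finsetSum _ (fun k _ => M.iter_nc L hα hT hS k)) t ht
  · intro y hy
    have := hC 0 K y ⟨hna.trans (le_of_lt hy.1), (le_of_lt hy.2)⟩
    simp only [zero_add] at this
    exact this.trans hK

theorem nc_of_cp {n : ℕ} (hK : ∀ t, 0 < t → IsCompactOperator ⇑((M.Bop L)^[n] M.T t)) :
    ContinuousOn ((M.Bop L)^[n] M.T) (Ioi 0) := by
  cases n with
  | zero => exact M.T_normcont_of_compact le_rfl hK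
  | succ n =>
    rw [M.Bop_succ] at hK ⊢
    exact M.op_normcont_of_compact (L_SC L (M.Bop_iter_SC L M.T_SC _)) le_rfl hK

theorem part_b {R : ℝ → (X₀ →L[ℂ] X₀)} (hRsc : SCont R)
    (hRfix : ∀ t ∈ Ici (0:ℝ), R t = M.T t + M.Bop L R t) {α : ℝ} (hα : 0 ≤ α)
    (hT : ∀ t, α < t → IsCompactOperator ⇑(M.T t)) {n : ℕ}
    (hS : ∀ t, 0 < t → IsCompactOperator ⇑((M.Bop L)^[n] M.T t)) {t : ℝ} (ht : (n:ℝ) * α < t) :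
    IsCompactOperator ⇑(R t) := by
  have := M.complete
  have hna : 0 ≤ (n:ℝ) * α := by positivity
  have hc : ∀ k, IsCompactOperator ⇑((M.Bop L)^[k] M.T t) := by
    intro k
    rcases lt_or_ge k n with h | h
    · refine M.iter_cp_lt L hα hT k t (lt_of_le_of_lt ?_ ht)
      have : ((k:ℝ) + 1) ≤ n := by exact_mod_cast h
      exact mul_le_mul_of_nonneg_right this hα
    · obtain ⟨j, rfl⟩ := Nat.exists_eq_add_of_le h
      exact M.iter_cp_ge L (M.nc_of_cp L hS) hS j t (hna.trans_lt ht)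
  obtain ⟨C, hC0, hC⟩ := M.R_approx L hRsc hRfix t
  refine isCompactOperator_of_tendsto (l := atTop)
    (F := fun K : ℕ => ∑ k ∈ Finset.range K, (M.Bop L)^[k] M.T t) ?_
    (Eventually.of_forall fun K => compact_sum _ _ (fun k _ => hc k))
  have h0 : Tendsto (fun K : ℕ => ((1:ℝ) / 2) ^ K * C) atTop (𝓝 (0 * C)) :=
    (tendsto_pow_atTop_nhds_zero_of_lt_one (by norm_num) (by norm_num)).mul_const C
  rw [zero_mul] at h0
  refine (tendsto_iff_norm_sub_tendsto_zero (E := X₀ →L[ℂ] X₀)).2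
    (squeeze_zero (fun _ => norm_nonneg (E := X₀ →L[ℂ] X₀) _) (fun K => ?_) h0)
  have h1 := hC 0 K t ⟨(hna.trans_lt ht).le, le_rfl⟩
  simp only [zero_add] at h1
  exact (norm_sub_rev (E := X₀ →L[ℂ] X₀) _ _).trans_le h1

theorem bv_C1_shift {u : ℝ → X₀} (hu : ContinuousOn u (Ici 0)) {a α : ℝ} (ha : 0 ≤ a) (hα : 0 ≤ α)
    (hT : ∀ x, VC1 (fun s => M.T s x) α) (hS : ∀ x, VC1 (fun s => M.S s x) α)
    (h : VC1 u a) : VC1 (M.bv L u) (a + α) := by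
  obtain ⟨g, hg, hug⟩ := h
  have hf : ContinuousOn (fun s => L (u s)) (Ici 0) := L_cont L hu
  have hp := cont_shift hf ha
  have hq : ContinuousOn (fun r => L (u (a + r)) - L (u a)) (Ici 0) := hp.sub continuousOn_const
  have hg' : ContinuousOn (fun r => L (g (a + r))) (Ici 0) := cont_shift (L_cont L hg) le_rfl
  have hd : ∀ t ∈ Ici (0:ℝ), HasDerivWithinAt (fun r => L (u (a + r)) - L (u a))
      (L (g (a + t))) (Ici 0) t := by
    intro t ht
    have hm : MapsTo (fun r => a + r) (Ici (0:ℝ)) (Ici a) := fun r hr => by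
      simp only [mem_Ici] at *; linarith
    have h1 : HasDerivWithinAt (fun r : ℝ => a + r) 1 (Ici 0) t :=
      ((hasDerivAt_id t).const_add a).hasDerivWithinAt
    have h2 := (hug (a + t) (hm ht)).scomp t h1 hm
    rw [one_smul] at h2
    have h3 := ((L.restrictScalars ℝ).hasFDerivAt.comp_hasDerivWithinAt t h2).sub_const (L (u a))
    exact h3
  have hq1 : VC1 (M.SD (fun r => L (u (a + r)) - L (u a))) 0 :=
    ⟨_, M.SD_cont _ hg', M.SD_C1 hg' hd (by simp)⟩
  have := (((hT (M.SD (fun s => L (u s)) a)).shift a).add ((hS (L (u a))).shift a)).add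
    ((hq1.mono hα).shift a)
  refine this.congr (fun t ht => ?_)
  have ht' : 0 ≤ t - a := by simp only [mem_Ici] at ht; linarith
  have e := M.SD_shift hf ha ht'
  rw [add_sub_cancel] at e
  have e2 := M.SD_sub hp (continuousOn_const (c := L (u a))) ht'
  rw [M.SD_const _ ht'] at e2
  change M.SD (fun s => L (u s)) t = _
  rw [e, e2]
  abel

theorem iter_C1 {α : ℝ} (hα : 0 ≤ α)
    (hT : ∀ x, VC1 (fun s => M.T s x) α) (hS : ∀ x, VC1 (fun s => M.S s x) α) (x : X₀) (k : ℕ) :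
    VC1 ((M.bv L)^[k] (fun s => M.T s x)) (((k:ℝ) + 1) * α) := by
  induction k with
  | zero => simpa using hT x
  | succ k ih =>
    rw [Function.iterate_succ_apply']
    have := M.bv_C1_shift L (M.bv_iter_cont L (M.T_cont x) k) (a := ((k:ℝ)+1) * α)
      (by positivity) hα hT hS ih
    exact this.mono (le_of_eq (by push_cast; ring))

theorem bv_iter_deriv {u g : ℝ → X₀} (hg : ContinuousOn g (Ici 0))
    (hd : ∀ t ∈ Ici (0:ℝ), HasDerivWithinAt u (g t) (Ici 0) t) (hu0 : u 0 = 0) (k : ℕ) :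
    (M.bv L)^[k] u 0 = 0 ∧
    ∀ t ∈ Ici (0:ℝ), HasDerivWithinAt ((M.bv L)^[k] u) ((M.bv L)^[k] g t) (Ici 0) t := by
  have hu : ContinuousOn u (Ici 0) := fun t ht => (hd t ht).continuousWithinAt
  induction k with
  | zero => exact ⟨hu0, hd⟩
  | succ k ih =>
    rw [Function.iterate_succ_apply', Function.iterate_succ_apply']
    refine ⟨M.SD_at_zero (L_cont L (M.bv_iter_cont L hu k)), ?_⟩
    refine M.SD_C1 (L_cont L (M.bv_iter_cont L hg k)) (fun t ht => ?_) (by simp only [ih.1, map_zero])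
    exact (L.restrictScalars ℝ).hasFDerivAt.comp_hasDerivWithinAt t (ih.2 t ht)

/-- the Neumann series of a `C¹` function is `C¹` -/
theorem series_C1 {u g v : ℝ → X₀} (hg : ContinuousOn g (Ici 0))
    (hd : ∀ t ∈ Ici (0:ℝ), HasDerivWithinAt u (g t) (Ici 0) t) (hu0 : u 0 = 0)
    (hv : ∀ t ∈ Ici (0:ℝ), Tendsto (fun K : ℕ => ∑ k ∈ Finset.range K, (M.bv L)^[k] u t) atTop
      (𝓝 (v t))) : VC1 v 0 := by
  have := M.complete
  obtain ⟨lam, hl0, hw⟩ := M.bv_iter_bound L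
  have hb : ∀ b : ℝ, ∃ C, 0 ≤ C ∧ ∀ k : ℕ, ∀ t ∈ Icc 0 b, ‖(M.bv L)^[k] g t‖ ≤ (1 / 2) ^ k * C := by
    intro b
    obtain ⟨C, hC⟩ := isCompact_Icc.exists_bound_of_continuousOn
      (hg.mono (Icc_subset_Ici_self : Icc 0 b ⊆ Ici 0))
    refine ⟨max C 0 * Real.exp (lam * b), by positivity, fun k t ht => ?_⟩
    have h1 := hw g hg b (max C 0) (le_max_right _ _)
      (fun s hs => (hC s hs).trans (le_max_left _ _)) k t ht
    refine h1.trans ?_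
    rw [← mul_assoc]
    exact mul_le_mul_of_nonneg_left
      (Real.exp_le_exp.2 (mul_le_mul_of_nonneg_left ht.2 hl0)) (by positivity)
  have hsum : ∀ C : ℝ, Summable (fun k : ℕ => ((1:ℝ) / 2) ^ k * C) := fun C =>
    (summable_geometric_of_lt_one (by norm_num) (by norm_num)).mul_right C
  have hz : ContinuousOn (fun t => ∑' k : ℕ, (M.bv L)^[k] g t) (Ici 0) := by
    intro t ht
    obtain ⟨C, hC0, hC⟩ := hb (t + 1)
    have h1 : ContinuousOn (fun t => ∑' k : ℕ, (M.bv L)^[k] g t) (Icc 0 (t + 1)) :=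
      continuousOn_tsum (fun k => (M.bv_iter_cont L hg k).mono Icc_subset_Ici_self) (hsum C) hC
    refine (h1 t ⟨ht, by linarith⟩).mono_of_mem_nhdsWithin ?_
    rw [← Ici_inter_Iic]
    exact inter_mem self_mem_nhdsWithin (mem_nhdsWithin_of_mem_nhds (Iic_mem_nhds (by linarith)))
  refine ⟨_, hz, fun t ht => (hasDeriv_int hz ht).congr_of_mem (fun τ hτ => ?_) ht⟩
  have hτ' : 0 ≤ τ := hτ
  obtain ⟨C, hC0, hC⟩ := hb τ
  have hi : ∀ k, ∫ s in (0:ℝ)..τ, (M.bv L)^[k] g s = (M.bv L)^[k] u τ := by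
    intro k
    obtain ⟨h0, h1⟩ := M.bv_iter_deriv L hg hd hu0 k
    rw [intervalIntegral.integral_eq_sub_of_hasDeriv_right_of_le hτ'
      (fun s hs => ((h1 s hs.1).continuousWithinAt).mono Icc_subset_Ici_self)
      (fun s hs => (h1 s hs.1.le).mono (Ioi_subset_Ici hs.1.le))
      (((M.bv_iter_cont L hg k).mono Icc_subset_Ici_self).intervalIntegrable_of_Icc hτ'), h0, sub_zero]
  have hs := intervalIntegral.hasSum_integral_of_dominated_convergence (a := 0) (b := τ)
    (μ := volume) (F := fun k : ℕ => (M.bv L)^[k] g)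
    (f := fun t => ∑' k : ℕ, (M.bv L)^[k] g t) (fun k _ => (1 / 2) ^ k * C)
    (fun k => by
      rw [uIoc_of_le hτ']
      exact ((M.bv_iter_cont L hg k).mono (Ioc_subset_Icc_self.trans
        Icc_subset_Ici_self)).aestronglyMeasurable measurableSet_Ioc)
    (fun k => Eventually.of_forall fun s hs => by
      rw [uIoc_of_le hτ'] at hs
      exact hC k s ⟨hs.1.le, hs.2⟩)
    (Eventually.of_forall fun s hs => hsum C)
    (by simp)
    (Eventually.of_forall fun s hs => by
      rw [uIoc_of_le hτ'] at hs
      exact (Summable.of_norm_bounded (hsum C) (fun k => hC k s ⟨hs.1.le, hs.2⟩)).hasSum)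
  simp only [hi] at hs
  exact tendsto_nhds_unique (hv τ hτ) hs.tendsto_sum_nat

theorem part_c {R : ℝ → (X₀ →L[ℂ] X₀)} (hRsc : SCont R)
    (hRfix : ∀ t ∈ Ici (0:ℝ), R t = M.T t + M.Bop L R t) {α : ℝ} (hα : 0 ≤ α)
    {n : ℕ} (hn : 1 ≤ n)
    (hT : ∀ x, VC1 (fun s => M.T s x) α) (hS : ∀ x, VC1 (fun s => M.S s x) α)
    (hB : ∀ x, VC1 (fun s => (M.Bop L)^[n] M.T s x) 0) (x : X₀) :
    VC1 (fun s => R s x) ((n:ℝ) * α) := by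
  have hna : 0 ≤ (n:ℝ) * α := by positivity
  have hv : VC1 (fun t => (M.Bop L)^[n] R t x) 0 := by
    obtain ⟨g, hg, hd⟩ := hB x
    refine M.series_C1 L hg hd ?_ ?_
    · obtain ⟨m, rfl⟩ := Nat.exists_eq_add_of_le' hn
      have h1 := M.SDop_apply _ (L_SC L (M.Bop_iter_SC L M.T_SC m)) 0 x
      rw [M.SD_at_zero (L_SC L (M.Bop_iter_SC L M.T_SC m) x)] at h1
      rw [M.Bop_succ]
      exact h1
    · intro t ht
      obtain ⟨C, hC0, hC⟩ := M.R_approx L hRsc hRfix t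
      have h0 : Tendsto (fun K : ℕ => ((1:ℝ) / 2) ^ K * (C * ‖x‖)) atTop (𝓝 (0 * (C * ‖x‖))) :=
        (tendsto_pow_atTop_nhds_zero_of_lt_one (by norm_num) (by norm_num)).mul_const _
      rw [zero_mul] at h0
      refine tendsto_iff_norm_sub_tendsto_zero.2
        (squeeze_zero (fun _ => norm_nonneg _) (fun K => ?_) h0)
      have e : ∀ k, (M.bv L)^[k] (fun s => (M.Bop L)^[n] M.T s x) t = (M.Bop L)^[n + k] M.T t x := by
        intro k
        rw [← M.Bop_iter_apply L (M.Bop_iter_SC L M.T_SC n) k x, ← Function.iterate_add_apply,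
          add_comm k n]
      rw [norm_sub_rev]
      have h1 := (ContinuousLinearMap.le_of_opNorm_le _ (hC n K t ⟨ht, le_rfl⟩) x)
      rw [_root_.sub_apply, ContinuousLinearMap.sum_apply] at h1
      simp only [e]
      refine h1.trans ?_
      rw [mul_assoc]
      refine mul_le_mul_of_nonneg_right ?_ (by positivity)
      exact pow_le_pow_of_le_one (by norm_num) (by norm_num) (by omega)
  have hs : VC1 (fun t => ∑ k ∈ Finset.range n, (M.Bop L)^[k] M.T t x) ((n:ℝ) * α) := by
    refine VC1.sum _ (fun k hk => ?_)
    rw [M.Bop_iter_apply L M.T_SC k x]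
    refine (M.iter_C1 L hα hT hS x k).mono (mul_le_mul_of_nonneg_right ?_ hα)
    exact_mod_cast Finset.mem_range.1 hk
  refine (hs.add (hv.mono hna)).congr (fun t ht => ?_)
  have h1 := M.R_expand L hRsc hRfix 0 n t (hna.trans ht)
  simp only [zero_add] at h1
  have h2 := congrArg (fun W : X₀ →L[ℂ] X₀ => W x) h1
  simpa [ContinuousLinearMap.sum_apply] using h2

end MRSetting

/-- eventual regularity of the perturbed semigroup. -/
theorem eventual_regularity_perturbation (M : MRSetting X X₀) (L : X₀ →L[ℂ] X)
    (R : ℝ → (X₀ →L[ℂ] X₀))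
    (hRsc : ∀ x : X₀, ContinuousOn (fun t => R t x) (Ici 0))
    (hRfix : ∀ t ∈ Ici (0:ℝ), R t = M.T t + M.Bop L R t)
    (α : ℝ) (hα : 0 ≤ α) (n : ℕ) :
    -- (a) norm continuity
    (ContinuousOn M.T (Ioi α) → ContinuousOn ((M.Bop L)^[n] M.T) (Ioi 0) →
      ContinuousOn R (Ioi ((n : ℝ) * α))) ∧
    -- (b) compactness
    ((∀ t : ℝ, α < t → IsCompactOperator ⇑(M.T t)) →
      (∀ t : ℝ, 0 < t → IsCompactOperator ⇑((M.Bop L)^[n] M.T t)) →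
      (∀ t : ℝ, (n : ℝ) * α < t → IsCompactOperator ⇑(R t)) ∧
        ContinuousOn R (Ioi ((n : ℝ) * α))) ∧
    -- (c) strong continuous differentiability
    (1 ≤ n → StronglyC1On M.T (Ici α) →
      (∀ x : X, ∃ g : ℝ → X₀, ContinuousOn g (Ici α) ∧
        ∀ t ∈ Ici α, HasDerivWithinAt (fun s => M.S s x) (g t) (Ici α) t) →
      StronglyC1On ((M.Bop L)^[n] M.T) (Ici 0) →
      StronglyC1On R (Ici ((n : ℝ) * α))) := by
  refine ⟨fun hT hS => M.part_a L hRsc hRfix hα hT hS, fun hT hS => ⟨fun t ht =>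
    M.part_b L hRsc hRfix hα hT hS ht,
    M.part_a L hRsc hRfix hα (M.T_normcont_of_compact hα hT) (M.nc_of_cp L hS)⟩,
    fun hn hT hS hB x => M.part_c L hRsc hRfix hα hn hT hS hB x⟩

end
end

section
/- (a) If t ↦ L ∘ T₀(t) is norm continuous on (0,∞), then S₁ and t ↦ R₀(t) − T₀(t) are norm continuous on (0,∞); consequently, in this case there exists t₀ ≥ 0 such that T₀ is norm continuous on (t₀,∞) if and only if there exists t₁ ≥ 0 such that R₀ is norm continuous on (t₁,∞). (b) If t ↦ L ∘ T₀(t) is norm continuous on (0,∞) and L ∘ T₀(t) is compact for every t > 0, then S₁ and R₀ − T₀ are norm continuous and compact on (0,∞); consequently, in this case there exists t₀ ≥ 0 such that T₀(t) is compact for all t > t₀ if and only if there exists t₁ ≥ 0 such that R₀(t) is compact for all t > t₁. -/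
open Set Filter MeasureTheory
open scoped Topology

noncomputable section

variable {X : Type*} [NormedAddCommGroup X] [NormedSpace ℂ X] [CompleteSpace X]
  {X₀ : Submodule ℂ X}

/-! ### Generic facts on operators -/

theorem MRgen_nonneg {E F : Type*} [NormedAddCommGroup E] [NormedSpace ℂ E]
    [NormedAddCommGroup F] [NormedSpace ℂ F] (V : E →L[ℂ] F) : 0 ≤ ‖V‖ := norm_nonneg _

theorem MRgen_zero {E F : Type*} [NormedAddCommGroup E] [NormedSpace ℂ E]
    [NormedAddCommGroup F] [NormedSpace ℂ F] (V : E →L[ℂ] F) (h : ‖V‖ ≤ 0) : V = 0 :=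
  norm_le_zero_iff.1 h

theorem MRgen_uc {E F : Type*} [NormedAddCommGroup E] [NormedSpace ℂ E]
    [NormedAddCommGroup F] [NormedSpace ℂ F] (V : ℝ → (E →L[ℂ] F)) (b : ℝ)
    (h : ContinuousOn V (Icc 0 b)) : ∀ e : ℝ, 0 < e → ∃ η : ℝ, 0 < η ∧ ∀ s ∈ Icc 0 b,
      ∀ t ∈ Icc 0 b, dist s t < η → ‖V s - V t‖ < e := by
  have := isCompact_Icc.uniformContinuousOn_of_continuous h
  rw [Metric.uniformContinuousOn_iff] at this
  simpa only [dist_eq_norm] using this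

theorem MRgen_contWithin {E F : Type*} [NormedAddCommGroup E] [NormedSpace ℂ E]
    [NormedAddCommGroup F] [NormedSpace ℂ F] (V : ℝ → (E →L[ℂ] F)) (D : Set ℝ) (t₀ : ℝ)
    (h : ∀ e : ℝ, 0 < e → ∃ η : ℝ, 0 < η ∧ ∀ t ∈ D, |t - t₀| < η → ‖V t - V t₀‖ < e) :
    ContinuousWithinAt V D t₀ := by
  rw [Metric.continuousWithinAt_iff]
  intro e he
  obtain ⟨η, h1, h2⟩ := h e he
  refine ⟨η, h1, fun t ht hd => ?_⟩
  rw [dist_eq_norm]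
  exact h2 t ht (by rwa [Real.dist_eq] at hd)

theorem MRgen_approx {E F : Type*} [NormedAddCommGroup E] [NormedSpace ℂ E]
    [NormedAddCommGroup F] [NormedSpace ℂ F] (V : ℝ → (E →L[ℂ] F)) (t₀ : ℝ) (N : Set ℝ)
    (hN : N ∈ 𝓝 t₀)
    (h : ∀ e : ℝ, 0 < e → ∃ G : ℝ → (E →L[ℂ] F), ContinuousAt G t₀ ∧
      ∀ t ∈ N, ‖V t - G t‖ ≤ e) :
    ContinuousAt V t₀ := by
  apply continuousAt_of_locally_uniform_approx_of_continuousAt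
  intro u hu
  obtain ⟨e, he, hu⟩ := Metric.mem_uniformity_dist.1 hu
  obtain ⟨G, h1, h2⟩ := h (e / 2) (by positivity)
  refine ⟨N, hN, G, h1, fun y hy => hu ?_⟩
  rw [dist_eq_norm]
  linarith [h2 y hy]

theorem MRgen_bern0 {G : Type*} [NormedAddCommGroup G] [NormedSpace ℝ G]
    (g : C(unitInterval, G)) (e : ℝ) (he : 0 < e) :
    ∃ n : ℕ, ∀ u, ‖g u - ∑ k : Fin (n + 1), bernstein n k u • g (bernstein.z k)‖ ≤ e := by
  have hlim := bernsteinApproximation_uniform g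
  rw [Metric.tendsto_atTop] at hlim
  obtain ⟨n, hn⟩ := hlim e he
  refine ⟨n, fun u => ?_⟩
  have hn := hn n le_rfl
  rw [← bernsteinApproximation.apply, ← dist_eq_norm, dist_comm]
  exact (ContinuousMap.dist_apply_le_dist u).trans hn.le

theorem MRgen_bern {E F : Type*} [NormedAddCommGroup E] [NormedSpace ℂ E]
    [NormedAddCommGroup F] [NormedSpace ℂ F] (g : unitInterval → (E →L[ℂ] F))
    (hg : Continuous g) (e : ℝ) (he : 0 < e) :
    ∃ n : ℕ, ∀ u, ‖g u - ∑ k : Fin (n + 1), bernstein n k u • g (bernstein.z k)‖ ≤ e :=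
  MRgen_bern0 ⟨g, hg⟩ e he

theorem MRgen_add_le {E F : Type*} [NormedAddCommGroup E] [NormedSpace ℂ E]
    [NormedAddCommGroup F] [NormedSpace ℂ F] (V W : E →L[ℂ] F) : ‖V + W‖ ≤ ‖V‖ + ‖W‖ :=
  norm_add_le _ _

theorem MRgen_sub_rev {E F : Type*} [NormedAddCommGroup E] [NormedSpace ℂ E]
    [NormedAddCommGroup F] [NormedSpace ℂ F] (V W : E →L[ℂ] F) : ‖V - W‖ = ‖W - V‖ :=
  norm_sub_rev _ _

/-! ### Helper lemmas -/

theorem MRaux_bdd {E F : Type*} [NormedAddCommGroup E] [NormedSpace ℂ E] [CompleteSpace E]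
    [NormedAddCommGroup F] [NormedSpace ℂ F] (V : ℝ → (E →L[ℂ] F))
    (hV : ∀ x : E, ContinuousOn (fun s => V s x) (Ici 0)) (b : ℝ) :
    ∃ C : ℝ, 0 ≤ C ∧ ∀ s ∈ Icc (0:ℝ) b, ‖V s‖ ≤ C := by
  have h : ∃ C', ∀ i : Icc (0:ℝ) b, ‖V i‖ ≤ C' := by
    apply banach_steinhaus
    intro x
    obtain ⟨C, hC⟩ := isCompact_Icc.exists_bound_of_continuousOn
      ((hV x).mono (Icc_subset_Ici_self : Icc (0:ℝ) b ⊆ Ici 0))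
    exact ⟨C, fun i => hC i i.2⟩
  obtain ⟨C, hC⟩ := h
  exact ⟨max C 0, le_max_right _ _, fun s hs => (hC ⟨s, hs⟩).trans (le_max_left _ _)⟩

/-- strong continuity on the half line passes to moving arguments -/
theorem MRaux_apply {E F : Type*} [NormedAddCommGroup E] [NormedSpace ℂ E] [CompleteSpace E]
    [NormedAddCommGroup F] [NormedSpace ℂ F] (V : ℝ → (E →L[ℂ] F))
    (hV : ∀ x : E, ContinuousOn (fun s => V s x) (Ici 0)) (f : ℝ → E) (D : Set ℝ)
    (hf : ContinuousOn f D) (g : ℝ → ℝ) (hg : ContinuousOn g D) (b : ℝ)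
    (hgD : MapsTo g D (Icc 0 b)) :
    ContinuousOn (fun s => V (g s) (f s)) D := by
  obtain ⟨C, hC0, hC⟩ := MRaux_bdd V hV b
  intro s₀ hs₀
  have h1 : Tendsto (fun s => V (g s) (f s₀)) (𝓝[D] s₀) (𝓝 (V (g s₀) (f s₀))) :=
    ((hV (f s₀)).comp hg (fun s hs => (hgD hs).1)) s₀ hs₀
  have h2 : Tendsto (fun s => V (g s) (f s - f s₀)) (𝓝[D] s₀) (𝓝 0) := by
    have h3 : Tendsto (fun s => C * ‖f s - f s₀‖) (𝓝[D] s₀) (𝓝 0) := by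
      have h4 : Tendsto (fun s => C * ‖f s - f s₀‖) (𝓝[D] s₀) (𝓝 (C * ‖f s₀ - f s₀‖)) :=
        ((hf s₀ hs₀).sub tendsto_const_nhds).norm.const_mul C
      simpa using h4
    refine squeeze_zero_norm' ?_ h3
    filter_upwards [self_mem_nhdsWithin] with s hs
    exact (V (g s)).le_of_opNorm_le (hC _ (hgD hs)) _
  have h5 := h1.add h2
  simp only [add_zero] at h5
  refine h5.congr fun s => ?_
  rw [← map_add]; congr 1; abel

theorem MRSetting.ker_cont_s13 (M : MRSetting X X₀) (f : ℝ → X) (hf : ContinuousOn f (Ici 0))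
    (t a b : ℝ) (ha : 0 ≤ a) (hb : b ≤ t) :
    ContinuousOn (fun s => M.S (t - s) (f s)) (Icc a b) := by
  refine MRaux_apply M.S M.S_cont f _ (hf.mono fun s hs => ha.trans hs.1) (fun s => t - s)
    (by fun_prop) t ?_
  intro s hs
  simp only [mem_Icc] at hs ⊢
  constructor <;> linarith

theorem MRSetting.ker_int_s13 (M : MRSetting X X₀) (f : ℝ → X) (hf : ContinuousOn f (Ici 0))
    (t a b : ℝ) (ha : 0 ≤ a) (hab : a ≤ b) (hb : b ≤ t) :
    IntervalIntegrable (fun s => M.S (t - s) (f s)) volume a b := by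
  apply ContinuousOn.intervalIntegrable
  rw [uIcc_of_le hab]
  exact M.ker_cont_s13 f hf t a b ha hb

theorem MRSetting.SD_add_smul (M : MRSetting X X₀) (f g : ℝ → X) (hf : ContinuousOn f (Ici 0))
    (hg : ContinuousOn g (Ici 0)) (c : ℂ) (t : ℝ) (ht : 0 ≤ t) :
    M.SD (fun s => f s + c • g s) t = M.SD f t + c • M.SD g t := by
  have h1 := M.SD_deriv (fun s => f s + c • g s) (hf.add (hg.const_smul c)) t ht
  have h2 := (M.SD_deriv f hf t ht).add ((M.SD_deriv g hg t ht).const_smul c)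
  refine (uniqueDiffOn_Ici (0:ℝ) t ht).eq_deriv _ h1 (h2.congr_of_mem ?_ ht)
  intro τ hτ
  simp only [map_add, map_smul, Pi.add_apply, Pi.smul_apply]
  have e := intervalIntegral.integral_add (g := fun s => c • M.S (τ - s) (g s))
    (M.ker_int_s13 f hf τ 0 τ le_rfl hτ le_rfl) ((M.ker_int_s13 g hg τ 0 τ le_rfl hτ le_rfl).smul c)
  rw [e, intervalIntegral.integral_smul]

theorem MRSetting.SD_le_s13 (M : MRSetting X X₀) (f : ℝ → X) (hf : ContinuousOn f (Ici 0))
    (t c : ℝ) (ht : 0 ≤ t) (h : ∀ s ∈ Icc (0:ℝ) t, ‖f s‖ ≤ c) :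
    ‖M.SD f t‖ ≤ M.δ t * c := by
  refine (M.SD_bound f hf t ht).trans (mul_le_mul_of_nonneg_left ?_ (M.δ_nonneg t ht))
  have : Nonempty (Icc (0:ℝ) t) := ⟨⟨0, le_rfl, ht⟩⟩
  exact ciSup_le fun s => h s s.2

theorem MRSetting.SD_sub_s13 (M : MRSetting X X₀) (f g : ℝ → X) (hf : ContinuousOn f (Ici 0))
    (hg : ContinuousOn g (Ici 0)) (t : ℝ) (ht : 0 ≤ t) :
    M.SD (fun s => f s - g s) t = M.SD f t - M.SD g t := by
  have := M.SD_add_smul f g hf hg (-1) t ht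
  simpa [sub_eq_add_neg] using this

theorem MRSetting.δ_zero_s13 (M : MRSetting X X₀) : M.δ 0 = 0 := by
  refine le_antisymm ?_ (M.δ_nonneg 0 le_rfl)
  refine ge_of_tendsto M.δ_lim ?_
  filter_upwards [self_mem_nhdsWithin] with t ht
  exact M.δ_mono (mem_Ici.2 le_rfl) (mem_Ici.2 (le_of_lt ht)) (le_of_lt ht)

theorem MRSetting.SD_zero (M : MRSetting X X₀) (f : ℝ → X) (hf : ContinuousOn f (Ici 0)) :
    M.SD f 0 = 0 := by
  have := M.SD_bound f hf 0 (mem_Ici.2 le_rfl)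
  rw [M.δ_zero_s13, zero_mul] at this
  exact norm_le_zero_iff.1 this

theorem MRaux_shift {E : Type*} [TopologicalSpace E] (f : ℝ → E) (hf : ContinuousOn f (Ici 0))
    (a : ℝ) (ha : 0 ≤ a) : ContinuousOn (fun s => f (a + s)) (Ici 0) := by
  refine hf.comp (by fun_prop) fun s hs => ?_
  simp only [mem_Ici] at hs ⊢
  linarith

theorem MRSetting.conv_shift (M : MRSetting X X₀) (f : ℝ → X) (hf : ContinuousOn f (Ici 0))
    (a t : ℝ) (ha : 0 ≤ a) (ht : 0 ≤ t) :
    (∫ s in (0:ℝ)..(a + t), M.S (a + t - s) (f s)) =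
      M.T t (∫ s in (0:ℝ)..a, M.S (a - s) (f s)) + M.S t (∫ s in (0:ℝ)..a, f s)
      + ∫ s in (0:ℝ)..t, M.S (t - s) (f (a + s)) := by
  have : CompleteSpace X₀ := M.closed.completeSpace_coe
  have hfi : IntervalIntegrable f volume 0 a := by
    apply ContinuousOn.intervalIntegrable
    rw [uIcc_of_le ha]
    exact hf.mono Icc_subset_Ici_self
  have hk := M.ker_int_s13 f hf a 0 a le_rfl ha le_rfl
  rw [← intervalIntegral.integral_add_adjacent_intervals
    (M.ker_int_s13 f hf (a + t) 0 a le_rfl ha (by linarith))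
    (M.ker_int_s13 f hf (a + t) a (a + t) ha (by linarith) le_rfl)]
  congr 1
  · rw [← ContinuousLinearMap.intervalIntegral_comp_comm _ hk,
      ← ContinuousLinearMap.intervalIntegral_comp_comm _ hfi,
      ← intervalIntegral.integral_add]
    · apply intervalIntegral.integral_congr
      intro s hs
      rw [uIcc_of_le ha] at hs
      simp only
      rw [M.TS t (a - s) ht (by linarith [hs.2]), show t + (a - s) = a + t - s by ring]
      abel
    · exact ⟨(M.T t).integrable_comp hk.1, (M.T t).integrable_comp hk.2⟩
    · exact ⟨(M.S t).integrable_comp hfi.1, (M.S t).integrable_comp hfi.2⟩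
  · have := intervalIntegral.integral_comp_add_left (a := 0) (b := t)
      (fun s => M.S (a + t - s) (f s)) a
    rw [add_zero] at this
    rw [← this]
    apply intervalIntegral.integral_congr
    intro s _
    simp only
    rw [show a + t - (a + s) = t - s by ring]

theorem MRSetting.SD_shift_s13 (M : MRSetting X X₀) (f : ℝ → X) (hf : ContinuousOn f (Ici 0))
    (a t : ℝ) (ha : 0 ≤ a) (ht : 0 ≤ t) :
    M.SD f (a + t) = M.T t (M.SD f a) + M.SD (fun s => f (a + s)) t := by
  set g : ℝ → X := fun s => f (a + s) with hg
  have hgc : ContinuousOn g (Ici 0) := MRaux_shift f hf a ha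
  set F : ℝ → X₀ := fun τ => ∫ s in (0:ℝ)..τ, M.S (τ - s) (f s) with hF
  set G : ℝ → X₀ := fun τ => ∫ s in (0:ℝ)..τ, M.S (τ - s) (g s) with hG
  have hcs : ∀ τ : ℝ, 0 ≤ τ →
      F (a + τ) = M.T τ (F a) + M.S τ (∫ s in (0:ℝ)..a, f s) + G τ :=
    fun τ hτ => M.conv_shift f hf a τ ha hτ
  have shiftD : ∀ (H : ℝ → X₀) (H' : X₀) (c : ℝ), 0 ≤ c → HasDerivWithinAt H H' (Ici 0) c →
      HasDerivWithinAt (fun h => H (c + h)) H' (Ici 0) 0 := by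
    intro H H' c hc hH
    have h0 : HasDerivWithinAt (fun h : ℝ => c + h) 1 (Ici 0) 0 :=
      ((hasDerivAt_id (0:ℝ)).const_add c).hasDerivWithinAt
    have h1 : HasDerivWithinAt H H' (Ici 0) (c + 0) := by simpa using hH
    have := HasDerivWithinAt.scomp (0:ℝ) h1 h0 (fun s hs => by
      simp only [mem_Ici] at hs ⊢; linarith)
    simpa [Function.comp_def] using this
  have d1 := shiftD F _ (a + t) (by linarith) (M.SD_deriv f hf (a + t) (by simp; linarith))
  have d2 := shiftD F _ a ha (M.SD_deriv f hf a ha)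
  have d3 := shiftD G _ t ht (M.SD_deriv g hgc t ht)
  have d4 := shiftD G _ 0 le_rfl (M.SD_deriv g hgc 0 (mem_Ici.2 le_rfl))
  have TD : ∀ (H : ℝ → X₀) (H' : X₀), HasDerivWithinAt H H' (Ici 0) (0:ℝ) →
      HasDerivWithinAt (fun h => M.T t (H h)) (M.T t H') (Ici 0) 0 := by
    intro H H' hH
    exact ((M.T t).restrictScalars ℝ).hasFDerivAt.comp_hasDerivWithinAt (0:ℝ) hH
  have d5 := (((TD _ _ d2).sub (TD _ _ d4)).add d3).add_const
    (F (a + t) - M.T t (F a) - G t)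
  have key : M.SD f (a + t) = M.T t (M.SD f a) - M.T t (M.SD g 0) + M.SD g t := by
    refine (uniqueDiffOn_Ici (0:ℝ) 0 (mem_Ici.2 le_rfl)).eq_deriv _ d1
      (d5.congr_of_mem ?_ (mem_Ici.2 le_rfl))
    intro h hh
    have hh : (0:ℝ) ≤ h := hh
    have e1 := hcs (t + h) (by linarith)
    have e2 := hcs t ht
    have e3 := hcs h hh
    have e4 : M.T (t + h) (F a) = M.T t (M.T h (F a)) := by
      rw [M.T_add t h ht hh]; rfl
    have e5 := M.TS t h ht hh (∫ s in (0:ℝ)..a, f s)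
    have e6 : M.T t (F (a + h)) = M.T t (M.T h (F a)) +
        M.T t (M.S h (∫ s in (0:ℝ)..a, f s)) + M.T t (G h) := by
      rw [e3, map_add, map_add]
    simp only [Pi.add_apply, Pi.sub_apply, zero_add]
    rw [add_assoc a t h, e1, e6, e2, e4, e5]
    abel
  rw [key, M.SD_zero g hgc, map_zero, sub_zero]

theorem MRSetting.SDop_sub_le (M : MRSetting X X₀) (V W : ℝ → (X₀ →L[ℂ] X))
    (hV : ∀ x : X₀, ContinuousOn (fun s => V s x) (Ici 0))
    (hW : ∀ x : X₀, ContinuousOn (fun s => W s x) (Ici 0)) (t c : ℝ) (ht : 0 ≤ t)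
    (hc : ∀ s ∈ Icc (0:ℝ) t, ‖V s - W s‖ ≤ c) :
    ‖M.SDop V t - M.SDop W t‖ ≤ M.δ t * c := by
  have hc0 : 0 ≤ c := (MRgen_nonneg _).trans (hc 0 ⟨le_rfl, ht⟩)
  refine ContinuousLinearMap.opNorm_le_bound _ (mul_nonneg (M.δ_nonneg t ht) hc0) fun x => ?_
  rw [sub_apply, M.SDop_apply V hV, M.SDop_apply W hW,
    ← M.SD_sub_s13 _ _ (hV x) (hW x) t ht, mul_assoc]
  refine M.SD_le_s13 _ ((hV x).sub (hW x)) t _ ht fun s hs => ?_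
  change ‖(V s - W s) x‖ ≤ _
  exact (V s - W s).le_of_opNorm_le (hc s hs) x

theorem MRSetting.SDop_le (M : MRSetting X X₀) (V : ℝ → (X₀ →L[ℂ] X))
    (hV : ∀ x : X₀, ContinuousOn (fun s => V s x) (Ici 0)) (t c : ℝ) (ht : 0 ≤ t)
    (hc : ∀ s ∈ Icc (0:ℝ) t, ‖V s‖ ≤ c) :
    ‖M.SDop V t‖ ≤ M.δ t * c := by
  have hc0 : 0 ≤ c := (MRgen_nonneg _).trans (hc 0 ⟨le_rfl, ht⟩)
  refine ContinuousLinearMap.opNorm_le_bound _ (mul_nonneg (M.δ_nonneg t ht) hc0) fun x => ?_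
  rw [M.SDop_apply V hV, mul_assoc]
  exact M.SD_le_s13 _ (hV x) t _ ht fun s hs => (V s).le_of_opNorm_le (hc s hs) x

theorem MRSetting.SDop_sc (M : MRSetting X X₀) (V : ℝ → (X₀ →L[ℂ] X))
    (hV : ∀ x : X₀, ContinuousOn (fun s => V s x) (Ici 0)) (x : X₀) :
    ContinuousOn (fun t => M.SDop V t x) (Ici 0) :=
  (M.SD_cont _ (hV x)).congr fun t _ => M.SDop_apply V hV t x

theorem MRSetting.SDop_shift (M : MRSetting X X₀) (V : ℝ → (X₀ →L[ℂ] X))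
    (hV : ∀ x : X₀, ContinuousOn (fun s => V s x) (Ici 0)) (a t : ℝ) (ha : 0 ≤ a) (ht : 0 ≤ t) :
    M.SDop V (a + t) = (M.T t).comp (M.SDop V a) + M.SDop (fun s => V (a + s)) t := by
  ext1 x
  rw [add_apply, ContinuousLinearMap.comp_apply, M.SDop_apply V hV, M.SDop_apply V hV,
    M.SDop_apply _ (fun x => MRaux_shift _ (hV x) a ha), M.SD_shift_s13 _ (hV x) a t ha ht]

theorem MRSetting.δ_small_s13 (M : MRSetting X X₀) (C e r : ℝ) (he : 0 < e) (hr : 0 < r) :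
    ∃ η : ℝ, 0 < η ∧ η < r ∧ C * M.δ η < e := by
  have h1 : Tendsto (fun t => C * M.δ t) (𝓝[>] 0) (𝓝 0) := by
    simpa using M.δ_lim.const_mul C
  have h2 := h1.eventually (gt_mem_nhds he)
  have h3 : ∀ᶠ t in 𝓝[>] (0:ℝ), t < r := nhdsWithin_le_nhds (gt_mem_nhds hr)
  obtain ⟨η, ⟨h4, h5⟩, h6⟩ := ((h2.and h3).and self_mem_nhdsWithin).exists
  exact ⟨η, h6, h5, h4⟩

/-- norm continuity up to `0` -/
theorem MRSetting.SDop_cont_closed (M : MRSetting X X₀) (W : ℝ → (X₀ →L[ℂ] X))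
    (hW : ContinuousOn W (Ici 0)) : ContinuousOn (M.SDop W) (Ici 0) := by
  have : CompleteSpace X₀ := M.closed.completeSpace_coe
  have hWs : ∀ x : X₀, ContinuousOn (fun s => W s x) (Ici 0) := fun x =>
    hW.clm_apply continuousOn_const
  intro t₀ ht₀
  have ht₀ : (0:ℝ) ≤ t₀ := ht₀
  set b := t₀ + 1 with hb
  obtain ⟨CT, hCT0, hCT⟩ := MRaux_bdd M.T M.T_cont b
  obtain ⟨CW, hCW0, hCW⟩ := MRaux_bdd W hWs b
  have huc := MRgen_uc W b (hW.mono (Icc_subset_Ici_self : Icc (0:ℝ) b ⊆ Ici 0))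
  apply MRgen_contWithin
  intro e he
  have hδb := M.δ_nonneg b (by linarith)
  obtain ⟨η₁, hη₁, hη₁'⟩ := huc (e / 3 / (M.δ b + 1)) (by positivity)
  obtain ⟨η₂, hη₂, -, hη₂'⟩ := M.δ_small_s13 (CT * CW) (e / 3) 1 (by positivity) one_pos
  have key : ∀ t' ∈ Icc (0:ℝ) b, ∀ h : ℝ, 0 ≤ h → h < η₁ → h < η₂ → h + t' ≤ b →
      ‖M.SDop W (h + t') - M.SDop W t'‖ < e := by
    intro t' ht' h hh h1 h2 h3
    have hsh : ∀ x : X₀, ContinuousOn (fun s => W (h + s) x) (Ici 0) :=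
      fun x => MRaux_shift _ (hWs x) h hh
    rw [M.SDop_shift W hWs h t' hh ht'.1, add_sub_assoc]
    have n1 : ‖(M.T t').comp (M.SDop W h)‖ ≤ CT * (M.δ η₂ * CW) := by
      refine (ContinuousLinearMap.opNorm_comp_le _ _).trans ?_
      refine mul_le_mul (hCT t' ht') ?_ (norm_nonneg _) hCT0
      refine (M.SDop_le W hWs h CW hh fun s hs => hCW s ⟨hs.1, by linarith [hs.2, ht'.1]⟩).trans ?_
      exact mul_le_mul_of_nonneg_right (M.δ_mono hh (mem_Ici.2 hη₂.le) h2.le) hCW0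
    have n2 : ‖M.SDop (fun s => W (h + s)) t' - M.SDop W t'‖ ≤
        M.δ t' * (e / 3 / (M.δ b + 1)) := by
      refine M.SDop_sub_le _ _ hsh hWs t' _ ht'.1 fun s hs => ?_
      refine (hη₁' _ ⟨by linarith [hs.1], by linarith [hs.2]⟩ _
        ⟨hs.1, by linarith [hs.2, ht'.2]⟩ ?_).le
      rw [Real.dist_eq, add_sub_cancel_right, abs_of_nonneg hh]
      exact h1
    have n3 : M.δ t' * (e / 3 / (M.δ b + 1)) ≤ e / 3 := by
      have : M.δ t' ≤ M.δ b + 1 := by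
        linarith [M.δ_mono (mem_Ici.2 ht'.1) (mem_Ici.2 (ht'.1.trans ht'.2)) ht'.2]
      calc M.δ t' * (e / 3 / (M.δ b + 1)) ≤ (M.δ b + 1) * (e / 3 / (M.δ b + 1)) :=
            mul_le_mul_of_nonneg_right this (by positivity)
        _ = e / 3 := by field_simp
    have n4 : CT * (M.δ η₂ * CW) < e / 3 := by
      calc CT * (M.δ η₂ * CW) = CT * CW * M.δ η₂ := by ring
        _ < e / 3 := hη₂'
    refine (MRgen_add_le _ _).trans_lt ?_
    linarith
  refine ⟨min (min η₁ η₂) 1, by positivity, ?_⟩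
  intro t ht hd
  have ht : (0:ℝ) ≤ t := ht
  rw [lt_min_iff, lt_min_iff] at hd
  obtain ⟨⟨h1, h2⟩, h3⟩ := hd
  rcases le_total t₀ t with h | h
  · rw [abs_of_nonneg (by linarith)] at h1 h2 h3
    have := key t₀ ⟨ht₀, by linarith⟩ (t - t₀) (by linarith) h1 h2 (by linarith)
    rwa [sub_add_cancel] at this
  · rw [abs_of_nonpos (by linarith), neg_sub] at h1 h2 h3
    have := key t ⟨ht, by linarith⟩ (t₀ - t) (by linarith) h1 h2 (by linarith)
    rwa [sub_add_cancel, MRgen_sub_rev] at this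

theorem MRaux_compact_limit {E F : Type*} [NormedAddCommGroup E] [NormedSpace ℂ E]
    [NormedAddCommGroup F] [NormedSpace ℂ F] [CompleteSpace F] (K : E →L[ℂ] F)
    (h : ∀ e : ℝ, 0 < e → ∃ K' : E →L[ℂ] F, IsCompactOperator K' ∧ ‖K - K'‖ ≤ e) :
    IsCompactOperator K := by
  have hcl : IsClosed {f : E →L[ℂ] F | IsCompactOperator f} :=
    isClosed_setOfPred_isCompactOperator
  have : K ∈ closure {f : E →L[ℂ] F | IsCompactOperator f} := by
    rw [Metric.mem_closure_iff]
    intro e he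
    obtain ⟨K', h1, h2⟩ := h (e / 2) (by positivity)
    exact ⟨K', h1, by rw [dist_eq_norm]; linarith⟩
  rwa [hcl.closure_eq] at this

/-- the operator `y ↦ (S ⋄ φ y)(t)` for scalar `φ` -/
def MRSetting.scal (M : MRSetting X X₀) (φ : ℝ → ℝ) (hφ : Continuous φ) (t : ℝ) (ht : 0 ≤ t)
    (c : ℝ) (hc : ∀ s, |φ s| ≤ c) : X →L[ℂ] X₀ :=
  LinearMap.mkContinuous
    { toFun := fun y => M.SD (fun s => φ s • y) t
      map_add' := fun y z => by
        have := M.SD_add_smul (fun s => φ s • y) (fun s => φ s • z)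
          (by fun_prop) (by fun_prop) 1 t ht
        simpa [smul_add] using this
      map_smul' := fun a y => by
        have h0 := M.SD_sub_s13 (fun s => φ s • y) (fun s => φ s • y)
          (by fun_prop) (by fun_prop) t ht
        have := M.SD_add_smul (fun _ => 0) (fun s => φ s • y)
          (by fun_prop) (by fun_prop) a t ht
        simp only [sub_self] at h0
        rw [h0] at this
        simp only [zero_add] at this
        simp only [RingHom.id_apply]
        rw [← this]
        congr 1
        funext s
        rw [smul_comm] }
    (M.δ t * c) (fun y => by
      rw [mul_assoc]
      refine M.SD_le_s13 _ (by fun_prop) t _ ht fun s _ => ?_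
      rw [norm_smul]
      exact mul_le_mul_of_nonneg_right (hc s) (norm_nonneg _))

theorem MRSetting.scal_apply (M : MRSetting X X₀) (φ : ℝ → ℝ) (hφ : Continuous φ) (t : ℝ)
    (ht : 0 ≤ t) (c : ℝ) (hc : ∀ s, |φ s| ≤ c) (y : X) :
    M.scal φ hφ t ht c hc y = M.SD (fun s => φ s • y) t := rfl

theorem MRSetting.SDop_sum_compact (M : MRSetting X X₀) {ι : Type*} (I : Finset ι)
    (φ : ι → ℝ → ℝ) (hφ : ∀ i, Continuous (φ i)) (c : ℝ) (hc : ∀ i s, |φ i s| ≤ c)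
    (K : ι → (X₀ →L[ℂ] X)) (hK : ∀ i, IsCompactOperator (K i)) (t : ℝ) (ht : 0 ≤ t) :
    IsCompactOperator (M.SDop (fun s => ∑ i ∈ I, φ i s • K i) t) := by
  classical
  have hsc : ∀ J : Finset ι, ∀ x : X₀,
      ContinuousOn (fun s => (∑ i ∈ J, φ i s • K i) x) (Ici 0) := by
    intro J x
    apply Continuous.continuousOn
    simp only [sum_apply, smul_apply]
    fun_prop
  have main : ∀ J : Finset ι, M.SDop (fun s => ∑ i ∈ J, φ i s • K i) t =
      ∑ i ∈ J, (M.scal (φ i) (hφ i) t ht c (hc i)).comp (K i) := by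
    intro J
    induction J using Finset.induction_on with
    | empty =>
      have := M.SDop_le _ (hsc ∅) t 0 ht
        (by intro s _; rw [Finset.sum_empty]; exact ContinuousLinearMap.opNorm_zero.le)
      rw [mul_zero] at this
      rw [MRgen_zero _ this, Finset.sum_empty]
    | insert j J hj ih =>
      rw [Finset.sum_insert hj, ← ih]
      ext1 x
      rw [M.SDop_apply _ (hsc _), add_apply, M.SDop_apply _ (hsc _),
        ContinuousLinearMap.comp_apply, M.scal_apply]
      have := M.SD_add_smul (fun s => φ j s • K j x) (fun s => (∑ i ∈ J, φ i s • K i) x)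
        (by fun_prop) (hsc J x) 1 t ht
      rw [one_smul] at this
      rw [← this]
      congr 1
      funext s
      rw [Finset.sum_insert hj, one_smul]
      rfl
  rw [main I]
  induction I using Finset.induction_on with
  | empty => rw [Finset.sum_empty]; exact isCompactOperator_zero
  | insert j J hj ih =>
    rw [Finset.sum_insert hj]
    exact ((hK j).clm_comp (M.scal (φ j) (hφ j) t ht c (hc j))).add ih

/-- compactness for kernels norm continuous up to `0` -/
theorem MRSetting.SDop_compact_closed (M : MRSetting X X₀) (W : ℝ → (X₀ →L[ℂ] X))
    (hW : ContinuousOn W (Ici 0)) (hK : ∀ s, 0 ≤ s → IsCompactOperator (W s)) (t : ℝ)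
    (ht : 0 < t) : IsCompactOperator (M.SDop W t) := by
  have : CompleteSpace X₀ := M.closed.completeSpace_coe
  have hWs : ∀ x : X₀, ContinuousOn (fun s => W s x) (Ici 0) := fun x =>
    hW.clm_apply continuousOn_const
  let g : unitInterval → (X₀ →L[ℂ] X) := fun u => W (t * u)
  have hg : Continuous g := by
    refine hW.comp_continuous (by fun_prop) fun u => ?_
    exact mul_nonneg ht.le u.2.1
  let p : ℝ → unitInterval := fun s => projIcc 0 1 zero_le_one (s / t)
  have hp : Continuous p := continuous_projIcc.comp (by fun_prop)
  have hps : ∀ s ∈ Icc (0:ℝ) t, t * (p s : ℝ) = s := by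
    intro s hs
    have : s / t ∈ Icc (0:ℝ) 1 := ⟨div_nonneg hs.1 ht.le, (div_le_one ht).2 hs.2⟩
    simp only [p, projIcc_of_mem _ this]
    field_simp
  apply MRaux_compact_limit
  intro e he
  have hδ := M.δ_nonneg t ht.le
  obtain ⟨n, hn⟩ := MRgen_bern g hg (e / (M.δ t + 1)) (by positivity)
  refine ⟨M.SDop (fun s => ∑ k : Fin (n + 1), bernstein n k (p s) • g (bernstein.z k)) t, ?_, ?_⟩
  · refine M.SDop_sum_compact Finset.univ (fun (k : Fin (n + 1)) s => bernstein n k (p s)) (fun k => by fun_prop) 1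
      ?_ (fun k => g (bernstein.z k)) (fun k => hK _ (mul_nonneg ht.le (bernstein.z k).2.1)) t ht.le
    intro k s
    rw [abs_of_nonneg bernstein_nonneg, ← bernstein.probability n (p s)]
    exact Finset.single_le_sum (f := fun k : Fin (n + 1) => bernstein n k (p s))
      (fun _ _ => bernstein_nonneg) (Finset.mem_univ k)
  · have hb : M.δ t * (e / (M.δ t + 1)) ≤ e := by
      calc M.δ t * (e / (M.δ t + 1)) ≤ (M.δ t + 1) * (e / (M.δ t + 1)) :=
            mul_le_mul_of_nonneg_right (by linarith) (by positivity)
        _ = e := by field_simp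
    refine le_trans ?_ hb
    refine M.SDop_sub_le _ _ hWs ?_ t _ ht.le ?_
    · intro x
      apply Continuous.continuousOn
      simp only [sum_apply, smul_apply]
      fun_prop
    · intro s hs
      have h1 : W s = g (p s) := by
        change W s = W (t * (p s : ℝ))
        rw [hps s hs]
      rw [h1]
      exact hn (p s)

theorem MRSetting.SDop_approx (M : MRSetting X X₀) (V : ℝ → (X₀ →L[ℂ] X))
    (hV : ∀ x : X₀, ContinuousOn (fun s => V s x) (Ici 0)) (b e r : ℝ) (he : 0 < e)
    (hr : 0 < r) :
    ∃ ε : ℝ, 0 < ε ∧ ε < r ∧ ∀ t ∈ Icc ε b,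
      ‖M.SDop V t - M.SDop (fun s => V (ε + s)) (t - ε)‖ ≤ e := by
  have : CompleteSpace X₀ := M.closed.completeSpace_coe
  obtain ⟨CT, hCT0, hCT⟩ := MRaux_bdd M.T M.T_cont b
  obtain ⟨CV, hCV0, hCV⟩ := MRaux_bdd V hV b
  obtain ⟨ε, h1, h2, h3⟩ := M.δ_small_s13 (CT * CV) e r he hr
  refine ⟨ε, h1, h2, fun t ht => ?_⟩
  have hs := M.SDop_shift V hV ε (t - ε) h1.le (by linarith [ht.1])
  rw [add_sub_cancel] at hs
  rw [hs, add_sub_cancel_right]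
  refine (ContinuousLinearMap.opNorm_comp_le _ _).trans ?_
  have n1 : ‖M.SDop V ε‖ ≤ M.δ ε * CV :=
    M.SDop_le V hV ε CV h1.le fun s hs => hCV s ⟨hs.1, by linarith [hs.2, ht.1, ht.2]⟩
  have n2 : ‖M.T (t - ε)‖ ≤ CT := hCT _ ⟨by linarith [ht.1], by linarith [ht.2]⟩
  calc ‖M.T (t - ε)‖ * ‖M.SDop V ε‖ ≤ CT * (M.δ ε * CV) :=
        mul_le_mul n2 n1 (MRgen_nonneg _) hCT0
    _ = CT * CV * M.δ ε := by ring
    _ ≤ e := h3.le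

theorem MRaux_shift_pos {E : Type*} [TopologicalSpace E] (f : ℝ → E)
    (hf : ContinuousOn f (Ioi 0)) (a : ℝ) (ha : 0 < a) :
    ContinuousOn (fun s => f (a + s)) (Ici 0) := by
  refine hf.comp (by fun_prop) fun s hs => ?_
  simp only [mem_Ici, mem_Ioi] at hs ⊢
  linarith

theorem MRSetting.SDop_cont (M : MRSetting X X₀) (V : ℝ → (X₀ →L[ℂ] X))
    (hV : ∀ x : X₀, ContinuousOn (fun s => V s x) (Ici 0)) (hVn : ContinuousOn V (Ioi 0)) :
    ContinuousOn (M.SDop V) (Ioi 0) := by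
  intro t₀ ht₀
  have ht₀ : (0:ℝ) < t₀ := ht₀
  apply ContinuousAt.continuousWithinAt
  apply MRgen_approx (M.SDop V) t₀ (Ioo (t₀ / 2) (t₀ + 1))
    (Ioo_mem_nhds (by linarith) (by linarith))
  intro e he
  obtain ⟨ε, h1, h2, h3⟩ := M.SDop_approx V hV (t₀ + 1) e (t₀ / 2) he (by linarith)
  refine ⟨fun t => M.SDop (fun s => V (ε + s)) (t - ε), ?_,
    fun t ht => h3 t ⟨by linarith [ht.1], ht.2.le⟩⟩
  have hc := M.SDop_cont_closed _ (MRaux_shift_pos V hVn ε h1)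
  have hc' : ContinuousAt (M.SDop (fun s => V (ε + s))) (t₀ - ε) :=
    hc.continuousAt (Ici_mem_nhds (by linarith))
  exact ContinuousAt.comp (f := fun t => t - ε) hc' (by fun_prop)

theorem MRSetting.SDop_compact (M : MRSetting X X₀) (V : ℝ → (X₀ →L[ℂ] X))
    (hV : ∀ x : X₀, ContinuousOn (fun s => V s x) (Ici 0)) (hVn : ContinuousOn V (Ioi 0))
    (hK : ∀ s, 0 < s → IsCompactOperator (V s)) (t : ℝ) (ht : 0 < t) :
    IsCompactOperator (M.SDop V t) := by
  have : CompleteSpace X₀ := M.closed.completeSpace_coe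
  apply MRaux_compact_limit
  intro e he
  obtain ⟨ε, h1, h2, h3⟩ := M.SDop_approx V hV t e t he ht
  refine ⟨_, ?_, h3 t ⟨h2.le, le_rfl⟩⟩
  exact M.SDop_compact_closed _ (MRaux_shift_pos V hVn ε h1)
    (fun s hs => hK _ (by linarith)) _ (by linarith)

/-- Picard iteration on a short window -/
theorem MRSetting.window (M : MRSetting X X₀) (L : X₀ →L[ℂ] X) (V G : ℝ → (X₀ →L[ℂ] X))
    (hV : ∀ x : X₀, ContinuousOn (fun s => V s x) (Ici 0))
    (hG : ∀ x : X₀, ContinuousOn (fun s => G s x) (Ici 0)) (hGn : ContinuousOn G (Ioi 0))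
    (hfix : ∀ t, 0 ≤ t → V t = G t + L.comp (M.SDop V t)) (τ : ℝ) (hτ : 0 < τ)
    (hsmall : ‖L‖ * M.δ τ ≤ 1 / 2) :
    (∀ t ∈ Ioo 0 τ, ContinuousAt V t) ∧
    ((∀ s, 0 < s → IsCompactOperator (G s)) → ∀ t ∈ Ioo 0 τ, IsCompactOperator (V t)) := by
  have : CompleteSpace X₀ := M.closed.completeSpace_coe
  obtain ⟨C₁, hC₁0, hC₁⟩ := MRaux_bdd V hV τ
  obtain ⟨C₂, hC₂0, hC₂⟩ := MRaux_bdd G hG τ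
  have step : ∀ n : ℕ, ∃ W : ℝ → (X₀ →L[ℂ] X),
      (∀ x : X₀, ContinuousOn (fun s => W s x) (Ici 0)) ∧ ContinuousOn W (Ioi 0) ∧
      ((∀ s, 0 < s → IsCompactOperator (G s)) → ∀ t, 0 < t → IsCompactOperator (W t)) ∧
      ∀ s ∈ Icc 0 τ, ‖V s - W s‖ ≤ (C₁ + C₂) * (1 / 2) ^ n := by
    intro n
    induction n with
    | zero =>
      refine ⟨G, hG, hGn, fun h => h, fun s hs => ?_⟩
      rw [pow_zero, mul_one, sub_eq_add_neg]
      refine (MRgen_add_le _ _).trans ?_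
      have : ‖-G s‖ = ‖G s‖ := ContinuousLinearMap.opNorm_neg _
      rw [this]
      exact add_le_add (hC₁ s hs) (hC₂ s hs)
    | succ n ih =>
      obtain ⟨W, h1, h2, h3, h4⟩ := ih
      refine ⟨fun t => G t + L.comp (M.SDop W t), ?_, ?_, ?_, ?_⟩
      · intro x
        exact (hG x).add (L.continuous.comp_continuousOn (M.SDop_sc W h1 x))
      · exact hGn.add (continuousOn_const.clm_comp (M.SDop_cont W h1 h2))
      · intro h t ht
        exact (h t ht).add ((M.SDop_compact W h1 h2 (h3 h) t ht).clm_comp L)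
      · intro s hs
        rw [hfix s hs.1, add_sub_add_left_eq_sub, ← ContinuousLinearMap.comp_sub]
        refine (ContinuousLinearMap.opNorm_comp_le _ _).trans ?_
        have hq : 0 ≤ (C₁ + C₂) * (1 / 2) ^ n := by positivity
        have n1 : ‖M.SDop V s - M.SDop W s‖ ≤ M.δ τ * ((C₁ + C₂) * (1 / 2) ^ n) := by
          refine (M.SDop_sub_le V W hV h1 s _ hs.1
            fun u hu => h4 u ⟨hu.1, hu.2.trans hs.2⟩).trans ?_
          exact mul_le_mul_of_nonneg_right (M.δ_mono hs.1 (mem_Ici.2 hτ.le) hs.2) hq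
        calc ‖L‖ * ‖M.SDop V s - M.SDop W s‖
            ≤ ‖L‖ * (M.δ τ * ((C₁ + C₂) * (1 / 2) ^ n)) :=
              mul_le_mul_of_nonneg_left n1 (MRgen_nonneg _)
          _ = (‖L‖ * M.δ τ) * ((C₁ + C₂) * (1 / 2) ^ n) := by ring
          _ ≤ 1 / 2 * ((C₁ + C₂) * (1 / 2) ^ n) := mul_le_mul_of_nonneg_right hsmall hq
          _ = (C₁ + C₂) * (1 / 2) ^ (n + 1) := by ring
  have lim : ∀ e : ℝ, 0 < e → ∃ n : ℕ, (C₁ + C₂) * (1 / 2) ^ n ≤ e := by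
    intro e he
    have h1 : Tendsto (fun n : ℕ => (C₁ + C₂) * (1 / 2 : ℝ) ^ n) atTop (𝓝 0) := by
      simpa using (tendsto_pow_atTop_nhds_zero_of_lt_one (by norm_num : (0:ℝ) ≤ 1 / 2)
        (by norm_num)).const_mul (C₁ + C₂)
    obtain ⟨n, hn⟩ := (h1.eventually (gt_mem_nhds he)).exists
    exact ⟨n, hn.le⟩
  constructor
  · intro t ht
    apply MRgen_approx V t (Ioo 0 τ) (Ioo_mem_nhds ht.1 ht.2)
    intro e he
    obtain ⟨n, hn⟩ := lim e he
    obtain ⟨W, h1, h2, h3, h4⟩ := step n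
    exact ⟨W, h2.continuousAt (Ioi_mem_nhds ht.1),
      fun s hs => (h4 s ⟨hs.1.le, hs.2.le⟩).trans hn⟩
  · intro h t ht
    apply MRaux_compact_limit
    intro e he
    obtain ⟨n, hn⟩ := lim e he
    obtain ⟨W, h1, h2, h3, h4⟩ := step n
    exact ⟨W t, h3 h t ht.1, (h4 t ⟨ht.1.le, ht.2.le⟩).trans hn⟩

theorem MRSetting.LR_reg (M : MRSetting X X₀) (L : X₀ →L[ℂ] X)
    (R : ℝ → (X₀ →L[ℂ] X₀))
    (hRsc : ∀ x : X₀, ContinuousOn (fun t => R t x) (Ici 0))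
    (hRfix : ∀ t ∈ Ici (0:ℝ), R t = M.T t + M.Bop L R t)
    (hLT : ContinuousOn (fun t => L.comp (M.T t)) (Ioi 0)) :
    ContinuousOn (fun t => L.comp (R t)) (Ioi 0) ∧
    ((∀ t : ℝ, 0 < t → IsCompactOperator ⇑(L.comp (M.T t))) →
      ∀ t : ℝ, 0 < t → IsCompactOperator ⇑(L.comp (R t))) := by
  obtain ⟨τ, hτ, -, hsm⟩ := M.δ_small_s13 ‖L‖ (1 / 2) 1 (by norm_num) one_pos
  have hLR : ∀ x : X₀, ContinuousOn (fun s => L.comp (R s) x) (Ici 0) := fun x =>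
    L.continuous.comp_continuousOn (hRsc x)
  have win : ∀ a : ℝ, 0 ≤ a →
      (∀ t ∈ Ioo 0 τ, ContinuousAt (fun t => L.comp (R (a + t))) t) ∧
      ((∀ s, 0 < s → IsCompactOperator ⇑((L.comp (M.T s)).comp (R a))) →
        ∀ t ∈ Ioo 0 τ, IsCompactOperator ⇑(L.comp (R (a + t)))) := by
    intro a ha
    refine M.window L (fun t => L.comp (R (a + t))) (fun t => (L.comp (M.T t)).comp (R a))
      (fun x => MRaux_shift _ (hLR x) a ha) ?_ (hLT.clm_comp continuousOn_const) ?_ τ hτ hsm.le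
    · intro x
      exact L.continuous.comp_continuousOn (M.T_cont (R a x))
    · intro t ht
      have e1 : R (a + t) = (M.T t).comp (R a) + M.SDop (fun s => L.comp (R (a + s))) t := by
        rw [hRfix (a + t) (by simp only [mem_Ici]; linarith)]
        have e2 := M.SDop_shift (fun s => L.comp (R s)) hLR a t ha ht
        rw [MRSetting.Bop, e2, add_comm a t, M.T_add t a ht ha, hRfix a ha,
          ContinuousLinearMap.comp_add, add_assoc, MRSetting.Bop]
      change L.comp (R (a + t)) = _
      rw [e1, ContinuousLinearMap.comp_add]
      rfl
  have loc : ∀ t : ℝ, 0 < t → ∃ a, 0 ≤ a ∧ t - a ∈ Ioo 0 τ := by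
    intro t ht
    refine ⟨max 0 (t - τ / 2), le_max_left _ _, ?_, ?_⟩
    · have : max 0 (t - τ / 2) < t := max_lt ht (by linarith)
      linarith
    · have := le_max_right 0 (t - τ / 2)
      linarith
  constructor
  · intro t ht
    obtain ⟨a, ha, hta⟩ := loc t ht
    apply ContinuousAt.continuousWithinAt
    have h1 := (win a ha).1 _ hta
    have h2 := ContinuousAt.comp (f := fun s => s - a) (x := t) h1 (by fun_prop)
    refine h2.congr (Eventually.of_forall fun s => ?_)
    simp only [Function.comp_apply, add_sub_cancel]
  · intro h t ht
    obtain ⟨a, ha, hta⟩ := loc t ht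
    have := (win a ha).2 (fun s hs => (h s hs).comp_clm (R a)) _ hta
    rwa [add_sub_cancel] at this

/-- regularity of `S₁` and of `R₀ − T₀` when `L ∘ T₀` is norm continuous
(resp. norm continuous and compact) on `(0,∞)`. -/
theorem S1_regularity (M : MRSetting X X₀) (L : X₀ →L[ℂ] X)
    (R : ℝ → (X₀ →L[ℂ] X₀))
    (hRsc : ∀ x : X₀, ContinuousOn (fun t => R t x) (Ici 0))
    (hRfix : ∀ t ∈ Ici (0:ℝ), R t = M.T t + M.Bop L R t)
    (hLT : ContinuousOn (fun t => L.comp (M.T t)) (Ioi 0)) :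
    -- (a)
    (ContinuousOn (M.Bop L M.T) (Ioi 0) ∧
     ContinuousOn (fun t => R t - M.T t) (Ioi 0) ∧
     ((∃ t₀ : ℝ, 0 ≤ t₀ ∧ ContinuousOn M.T (Ioi t₀)) ↔
       (∃ t₁ : ℝ, 0 ≤ t₁ ∧ ContinuousOn R (Ioi t₁)))) ∧
    -- (b)
    ((∀ t : ℝ, 0 < t → IsCompactOperator ⇑(L.comp (M.T t))) →
      ((∀ t : ℝ, 0 < t → IsCompactOperator ⇑(M.Bop L M.T t)) ∧
       ContinuousOn (fun t => R t - M.T t) (Ioi 0) ∧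
       (∀ t : ℝ, 0 < t → IsCompactOperator ⇑(R t - M.T t)) ∧
       ((∃ t₀ : ℝ, 0 ≤ t₀ ∧ ∀ t : ℝ, t₀ < t → IsCompactOperator ⇑(M.T t)) ↔
         (∃ t₁ : ℝ, 0 ≤ t₁ ∧ ∀ t : ℝ, t₁ < t → IsCompactOperator ⇑(R t))))) := by
  have hTs : ∀ x : X₀, ContinuousOn (fun s => L.comp (M.T s) x) (Ici 0) := fun x =>
    L.continuous.comp_continuousOn (M.T_cont x)
  have hRs : ∀ x : X₀, ContinuousOn (fun s => L.comp (R s) x) (Ici 0) := fun x =>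
    L.continuous.comp_continuousOn (hRsc x)
  obtain ⟨hLR, hLRK⟩ := M.LR_reg L R hRsc hRfix hLT
  have hdiff : ∀ t : ℝ, 0 < t → R t - M.T t = M.SDop (fun s => L.comp (R s)) t := by
    intro t ht
    rw [hRfix t (mem_Ici.2 ht.le), add_sub_cancel_left]
    rfl
  have hRT : ContinuousOn (fun t => R t - M.T t) (Ioi 0) :=
    (M.SDop_cont _ hRs hLR).congr fun t ht => hdiff t ht
  refine ⟨⟨M.SDop_cont _ hTs hLT, hRT, ?_, ?_⟩, ?_⟩
  · rintro ⟨t₀, h0, h⟩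
    refine ⟨t₀, h0, ?_⟩
    refine ((hRT.mono (Ioi_subset_Ioi h0)).add h).congr fun t _ => ?_
    exact (sub_add_cancel (R t) (M.T t)).symm
  · rintro ⟨t₀, h0, h⟩
    refine ⟨t₀, h0, ?_⟩
    refine (h.sub (hRT.mono (Ioi_subset_Ioi h0))).congr fun t _ => ?_
    exact (sub_sub_cancel (R t) (M.T t)).symm
  · intro hK
    have hRTK : ∀ t : ℝ, 0 < t → IsCompactOperator ⇑(R t - M.T t) := by
      intro t ht
      rw [hdiff t ht]
      exact M.SDop_compact _ hRs hLR (hLRK hK) t ht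
    refine ⟨fun t ht => M.SDop_compact _ hTs hLT hK t ht, hRT, hRTK, ?_, ?_⟩
    · rintro ⟨t₀, h0, h⟩
      refine ⟨t₀, h0, fun t ht => ?_⟩
      have := (hRTK t (h0.trans_lt ht)).add (h t ht)
      rw [← sub_add_cancel (R t) (M.T t)]
      exact this
    · rintro ⟨t₀, h0, h⟩
      refine ⟨t₀, h0, fun t ht => ?_⟩
      have := (h t ht).sub (hRTK t (h0.trans_lt ht))
      rw [← sub_sub_cancel (R t) (M.T t)]
      exact this

end
end
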